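/- (Theorem 2: two encoders/one decoder with lossless and lossy constraints, no side information.) In the setting where 𝒳3 is a singleton (node 3 observes no source), node 3 sends no messages (all 𝒥_3^l are singletons, R3=0), and the constraints are that node 3 reconstructs X_1^n losslessly and X_2^n with distortion target D32: a rate pair (R1,R2) is achievable if and only if there exist a finite set 𝒰 with |𝒰| ≤ |𝒳1||𝒳2|+1, a random variable U on 𝒰 jointly distributed with (X1,X2) (any joint pmf whose (X1,X2)-marginal equals the source pmf p_{X1X2}), and a map g32: 𝒳1×𝒰 → X̂2 with E[d2(X2, g32(X1,U))] ≤ D32, such that R1 ≥ H(X1|X2), R2 ≥ I(X2;U|X1), and R1+R2 ≥ H(X1) + I(X2;U|X1). -/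

import Mathlib

noncomputable section

namespace IT

variable {Ω : Type*} [Fintype Ω]

open Classical in
/-- Probability of an event under a weight function on a finite sample space. -/
def pr (w : Ω → ℝ) (E : Ω → Prop) : ℝ := ∑ ω, if E ω then w ω else 0

open Classical in
/-- The distribution (pmf) of a random variable. -/
def dist (w : Ω → ℝ) {α : Type*} [Fintype α] (X : Ω → α) (a : α) : ℝ :=
  ∑ ω, if X ω = a then w ω else 0

/-- Shannon entropy (base 2). -/
def H (w : Ω → ℝ) {α : Type*} [Fintype α] (X : Ω → α) : ℝ :=
  -∑ a, dist w X a * Real.logb 2 (dist w X a)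

/-- Conditional entropy H(X|Y). -/
def condH (w : Ω → ℝ) {α β : Type*} [Fintype α] [Fintype β] (X : Ω → α) (Y : Ω → β) : ℝ :=
  H w (fun ω => (X ω, Y ω)) - H w Y

/-- Mutual information I(X;Y). -/
def mutInfo (w : Ω → ℝ) {α β : Type*} [Fintype α] [Fintype β] (X : Ω → α) (Y : Ω → β) : ℝ :=
  H w X + H w Y - H w (fun ω => (X ω, Y ω))

/-- Conditional mutual information I(X;Y|Z). -/
def condMutInfo (w : Ω → ℝ) {α β γ : Type*} [Fintype α] [Fintype β] [Fintype γ]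
    (X : Ω → α) (Y : Ω → β) (Z : Ω → γ) : ℝ :=
  condH w X Z - condH w X (fun ω => (Y ω, Z ω))

/-- Expectation of a real random variable. -/
def expect (w : Ω → ℝ) (f : Ω → ℝ) : ℝ := ∑ ω, w ω * f ω

end IT

/-- `p` is a probability mass function on a finite type. -/
def IsPMF {α : Type*} [Fintype α] (p : α → ℝ) : Prop := (∀ a, 0 ≤ p a) ∧ ∑ a, p a = 1

/-- The i.i.d. (product) weight on `n`-sequences induced by a single-letter pmf. -/
def iidW {α : Type*} (p : α → ℝ) (n : ℕ) : (Fin n → α) → ℝ := fun x => ∏ t, p (x t)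

/-- The first `l` components of a dependent tuple (the rest masked). -/
def trunc {K : ℕ} {γ : Fin K → Type*} (l : ℕ) (f : (k : Fin K) → γ k) :
    (k : Fin K) → Option (γ k) :=
  fun k => if k.val < l then some (f k) else none

/-- Coordinates with (0-based) index `< t`. -/
def below {n : ℕ} {α : Type*} (t : ℕ) (x : Fin n → α) : Fin n → Option α :=
  fun s => if s.val < t then some (x s) else none

/-- Coordinates with (0-based) index `> t`. -/
def above {n : ℕ} {α : Type*} (t : ℕ) (x : Fin n → α) : Fin n → Option α :=
  fun s => if t < s.val then some (x s) else none

/-- Coordinates with (0-based) index `≥ t`. -/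
def fromIdx {n : ℕ} {α : Type*} (t : ℕ) (x : Fin n → α) : Fin n → Option α :=
  fun s => if t ≤ s.val then some (x s) else none

open Classical in
/-- Number of occurrences of `a` in the sequence `x`. -/
def Nocc {n : ℕ} {α : Type*} (a : α) (x : Fin n → α) : ℕ :=
  (Finset.univ.filter fun t => x t = a).card

/-- Strongly typical set. -/
def typical {α : Type*} [Fintype α] (Q : α → ℝ) (δ : ℝ) (n : ℕ) : Set (Fin n → α) :=
  {x | ∀ a, Q a ≠ 0 → |(Nocc a x : ℝ) / n - Q a| ≤ δ / Fintype.card α}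


open IT


set_option linter.unusedSectionVars false

/-! ### Basic facts -/

section Basics

variable {Ω : Type*} [Fintype Ω]

theorem sum_dist (w : Ω → ℝ) {α : Type*} [Fintype α] (X : Ω → α) (φ : α → ℝ) :
    ∑ a, IT.dist w X a * φ a = ∑ ω, w ω * φ (X ω) := by
  classical
  unfold IT.dist
  simp_rw [Finset.sum_mul, ite_mul, zero_mul]
  rw [Finset.sum_comm]
  refine Finset.sum_congr rfl fun ω _ => ?_
  simp

theorem H_eq_sum (w : Ω → ℝ) {α : Type*} [Fintype α] (X : Ω → α) :
    IT.H w X = -∑ ω, w ω * Real.logb 2 (IT.dist w X (X ω)) := by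
  rw [IT.H, sum_dist w X (fun a => Real.logb 2 (IT.dist w X a))]

variable {A B C : Type*} [Fintype A] [Fintype B] [Fintype C]

/-- first marginal -/
def mg1 (p : A × B → ℝ) (a : A) : ℝ := ∑ b, p (a, b)
/-- second marginal -/
def mg2 (p : A × B → ℝ) (b : B) : ℝ := ∑ a, p (a, b)
/-- marginal on first and third -/
def mg13 (q : A × B × C → ℝ) (a : A) (c : C) : ℝ := ∑ b, q (a, b, c)

theorem dist_1 (q : A × B × C → ℝ) (p : A × B → ℝ) (h : ∀ a b, (∑ c, q (a, b, c)) = p (a, b))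
    (a : A) : IT.dist q (fun v => v.1) a = mg1 p a := by
  classical
  unfold IT.dist mg1
  rw [Fintype.sum_prod_type, Finset.sum_eq_single a]
  · rw [Fintype.sum_prod_type]; simp [h]
  · intro b _ hb; simp [hb]
  · simp

theorem dist_2 (q : A × B × C → ℝ) (p : A × B → ℝ) (h : ∀ a b, (∑ c, q (a, b, c)) = p (a, b))
    (b : B) : IT.dist q (fun v => v.2.1) b = mg2 p b := by
  classical
  unfold IT.dist mg2
  rw [Fintype.sum_prod_type]
  refine Finset.sum_congr rfl fun a _ => ?_
  rw [Fintype.sum_prod_type, Finset.sum_eq_single b]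
  · simp [h]
  · intro b' _ hb; simp [hb]
  · simp

theorem dist_12 (q : A × B × C → ℝ) (p : A × B → ℝ) (h : ∀ a b, (∑ c, q (a, b, c)) = p (a, b))
    (a : A) (b : B) : IT.dist q (fun v => (v.1, v.2.1)) (a, b) = p (a, b) := by
  classical
  unfold IT.dist
  rw [Fintype.sum_prod_type, Finset.sum_eq_single a]
  · rw [Fintype.sum_prod_type, Finset.sum_eq_single b]
    · simp [h]
    · intro b' _ hb; simp [hb]
    · simp
  · intro b _ hb; simp [hb]
  · simp

theorem dist_21 (q : A × B × C → ℝ) (p : A × B → ℝ) (h : ∀ a b, (∑ c, q (a, b, c)) = p (a, b))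
    (a : A) (b : B) : IT.dist q (fun v => (v.2.1, v.1)) (b, a) = p (a, b) := by
  rw [← dist_12 q p h a b]
  unfold IT.dist
  refine Finset.sum_congr rfl fun x _ => ?_
  congr 1
  simp [and_comm]

theorem dist_31 (q : A × B × C → ℝ) (a : A) (c : C) :
    IT.dist q (fun v => (v.2.2, v.1)) (c, a) = mg13 q a c := by
  classical
  unfold IT.dist mg13
  rw [Fintype.sum_prod_type, Finset.sum_eq_single a]
  · rw [Fintype.sum_prod_type]; simp
  · intro b _ hb; simp [hb]
  · simp

theorem dist_231 (q : A × B × C → ℝ) (a : A) (b : B) (c : C) :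
    IT.dist q (fun v => (v.2.1, v.2.2, v.1)) (b, c, a) = q (a, b, c) := by
  classical
  unfold IT.dist
  rw [Finset.sum_eq_single (a, b, c)]
  · simp
  · rintro ⟨a', b', c'⟩ _ hb
    rw [if_neg]
    simp only [Prod.mk.injEq, ne_eq] at hb ⊢
    tauto
  · simp

/-- test-channel information in explicit form -/
def info (q : A × B × C → ℝ) (p : A × B → ℝ) : ℝ :=
  ∑ v, q v * (Real.logb 2 (q v / mg13 q v.1 v.2.2) - Real.logb 2 (p (v.1, v.2.1) / mg1 p v.1))

def hX1 (p : A × B → ℝ) : ℝ := -∑ x, p x * Real.logb 2 (mg1 p x.1)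

def hX1X2 (p : A × B → ℝ) : ℝ := -∑ x, p x * Real.logb 2 (p x / mg2 p x.2)

theorem sum_marg (q : A × B × C → ℝ) (p : A × B → ℝ) (h : ∀ a b, (∑ c, q (a, b, c)) = p (a, b))
    (φ : A × B → ℝ) : ∑ v, q v * φ (v.1, v.2.1) = ∑ x, p x * φ x := by
  rw [Fintype.sum_prod_type, Fintype.sum_prod_type]
  refine Finset.sum_congr rfl fun a _ => ?_
  rw [Fintype.sum_prod_type]
  refine Finset.sum_congr rfl fun b _ => ?_
  simp only
  rw [← Finset.sum_mul, h]

theorem le_mg13 (q : A × B × C → ℝ) (hq : ∀ v, 0 ≤ q v) (v : A × B × C) :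
    q v ≤ mg13 q v.1 v.2.2 := by
  obtain ⟨a, b, c⟩ := v
  exact Finset.single_le_sum (f := fun b => q (a, b, c)) (fun _ _ => hq _) (Finset.mem_univ b)

theorem le_marg (q : A × B × C → ℝ) (hq : ∀ v, 0 ≤ q v)
    (p : A × B → ℝ) (h : ∀ a b, (∑ c, q (a, b, c)) = p (a, b)) (v : A × B × C) :
    q v ≤ p (v.1, v.2.1) := by
  obtain ⟨a, b, c⟩ := v
  rw [← h]
  exact Finset.single_le_sum (f := fun c => q (a, b, c)) (fun _ _ => hq _) (Finset.mem_univ c)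

theorem le_mg1 (p : A × B → ℝ) (hp : ∀ v, 0 ≤ p v) (x : A × B) : p x ≤ mg1 p x.1 := by
  obtain ⟨a, b⟩ := x
  exact Finset.single_le_sum (f := fun b => p (a, b)) (fun _ _ => hp _) (Finset.mem_univ b)

theorem le_mg2 (p : A × B → ℝ) (hp : ∀ v, 0 ≤ p v) (x : A × B) : p x ≤ mg2 p x.2 := by
  obtain ⟨a, b⟩ := x
  exact Finset.single_le_sum (f := fun a => p (a, b)) (fun _ _ => hp _) (Finset.mem_univ a)

theorem marg_nonneg (q : A × B × C → ℝ) (hq : ∀ v, 0 ≤ q v)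
    (p : A × B → ℝ) (h : ∀ a b, (∑ c, q (a, b, c)) = p (a, b)) (x : A × B) : 0 ≤ p x := by
  obtain ⟨a, b⟩ := x
  rw [← h]
  exact Finset.sum_nonneg fun _ _ => hq _

theorem H_eq (q : A × B × C → ℝ) (p : A × B → ℝ) (h : ∀ a b, (∑ c, q (a, b, c)) = p (a, b)) :
    IT.H q (fun v => v.1) = hX1 p := by
  rw [H_eq_sum, hX1, ← sum_marg q p h]
  simp_rw [dist_1 q p h]

theorem condH_eq (q : A × B × C → ℝ) (hq : ∀ v, 0 ≤ q v)
    (p : A × B → ℝ) (h : ∀ a b, (∑ c, q (a, b, c)) = p (a, b)) :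
    IT.condH q (fun v => v.1) (fun v => v.2.1) = hX1X2 p := by
  rw [IT.condH, H_eq_sum, H_eq_sum, hX1X2, ← sum_marg q p h (fun x => Real.logb 2 (p x / mg2 p x.2))]
  rw [← sub_eq_zero, neg_sub_neg, sub_neg_eq_add, ← Finset.sum_sub_distrib,
    ← Finset.sum_add_distrib]
  refine Finset.sum_eq_zero fun v _ => ?_
  rw [dist_12 q p h, dist_2 q p h]
  rcases (hq v).eq_or_lt with h0 | h0
  · simp [← h0]
  · have h1 := h0.trans_le (le_marg q hq p h v)
    have h2 := h1.trans_le (le_mg2 p (marg_nonneg q hq p h) _)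
    rw [Real.logb_div h1.ne' h2.ne']
    ring

theorem condMutInfo_eq (q : A × B × C → ℝ) (hq : ∀ v, 0 ≤ q v)
    (p : A × B → ℝ) (h : ∀ a b, (∑ c, q (a, b, c)) = p (a, b)) :
    IT.condMutInfo q (fun v => v.2.1) (fun v => v.2.2) (fun v => v.1) = info q p := by
  rw [IT.condMutInfo, IT.condH, IT.condH, H_eq_sum, H_eq_sum, H_eq_sum, H_eq_sum, info]
  have : ∀ x y z t : ℝ, -x - -y - (-z - -t) = y - x - (t - z) := by intros; ring
  rw [this, ← Finset.sum_sub_distrib, ← Finset.sum_sub_distrib, ← Finset.sum_sub_distrib]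
  refine Finset.sum_congr rfl fun v _ => ?_
  rw [dist_21 q p h, dist_1 q p h, dist_31 q, dist_231]
  rcases (hq v).eq_or_lt with h0 | h0
  · simp [← h0]
  · have h1 := h0.trans_le (le_marg q hq p h v)
    have h2 := h1.trans_le (le_mg1 p (marg_nonneg q hq p h) _)
    have h3 := h0.trans_le (le_mg13 q hq v)
    rw [Real.logb_div h1.ne' h2.ne', Real.logb_div h0.ne' h3.ne']
    ring

end Basics

section ProductWeights

variable {ι V : Type*} [Fintype ι] [Fintype V]

theorem sum_prod_pi [DecidableEq ι] (h : ι → V → ℝ) :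
    ∑ ω : ι → V, ∏ r, h r (ω r) = ∏ r, ∑ v, h r v := by
  rw [Finset.prod_univ_sum, Fintype.piFinset_univ]

theorem sum_prodW [DecidableEq ι] (w : V → ℝ) (hw : ∑ v, w v = 1) :
    ∑ ω : ι → V, ∏ r, w (ω r) = 1 := by
  rw [sum_prod_pi (fun _ => w)]; simp [hw]

theorem marg_prodW [DecidableEq ι] (w : V → ℝ) (hw : ∑ v, w v = 1) (s : ι) (f : V → ℝ) :
    ∑ ω : ι → V, (∏ r, w (ω r)) * f (ω s) = ∑ v, w v * f v := by
  have : ∀ ω : ι → V, (∏ r, w (ω r)) * f (ω s) =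
      ∏ r, (fun r v => w v * if r = s then f v else 1) r (ω r) := by
    intro ω
    rw [Finset.prod_mul_distrib]
    simp
  refine (Finset.sum_congr rfl (fun ω _ => this ω)).trans
    ((sum_prod_pi (fun r v => w v * if r = s then f v else 1)).trans ?_)
  rw [Finset.prod_eq_single s]
  · simp
  · intro b _ hb; simp [hb, hw]
  · simp

theorem pair_prodW [DecidableEq ι] (w : V → ℝ) (hw : ∑ v, w v = 1) (s t : ι) (hst : s ≠ t)
    (f g : V → ℝ) :
    ∑ ω : ι → V, (∏ r, w (ω r)) * (f (ω s) * g (ω t)) = (∑ v, w v * f v) * ∑ v, w v * g v := by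
  have : ∀ ω : ι → V, (∏ r, w (ω r)) * (f (ω s) * g (ω t)) =
      ∏ r, (fun r v => w v * ((if r = s then f v else 1) * if r = t then g v else 1)) r (ω r) := by
    intro ω
    rw [Finset.prod_mul_distrib, Finset.prod_mul_distrib]
    simp
  refine (Finset.sum_congr rfl (fun ω _ => this ω)).trans
    ((sum_prod_pi (fun r v => w v * ((if r = s then f v else 1) * if r = t then g v else 1))).trans ?_)
  rw [Finset.prod_eq_mul s t hst]
  · simp [hst, hst.symm]
  · intro b _ hb; simp [hb.1, hb.2, hw]
  · simp
  · simp

end ProductWeights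


/-! ### Converse -/

section Converse

theorem gibbs {Ω : Type*} [Fintype Ω] (w r : Ω → ℝ) (hw : ∀ ω, 0 ≤ w ω) (h1 : ∑ ω, w ω = 1)
    (hr : ∀ ω, 0 < w ω → 0 < r ω) (M : ℝ) (hM : 0 < M) (hs : ∑ ω, w ω * r ω ≤ M) :
    ∑ ω, w ω * Real.logb 2 (r ω) ≤ Real.logb 2 M := by
  have hl2 : 0 < Real.log 2 := Real.log_pos (by norm_num)
  have key : ∀ ω, w ω * Real.logb 2 (r ω) ≤
      w ω * Real.logb 2 M + (w ω * r ω / M - w ω) / Real.log 2 := by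
    intro ω
    rcases (hw ω).eq_or_lt with h0 | h0
    · simp [← h0]
    · have hr' := hr ω h0
      have h2 : Real.log (r ω / M) ≤ r ω / M - 1 := Real.log_le_sub_one_of_pos (by positivity)
      rw [Real.log_div hr'.ne' hM.ne'] at h2
      unfold Real.logb
      have : w ω * (Real.log M / Real.log 2) + (w ω * r ω / M - w ω) / Real.log 2
          - w ω * (Real.log (r ω) / Real.log 2)
          = w ω * ((r ω / M - 1) - (Real.log (r ω) - Real.log M)) / Real.log 2 := by
        field_simp
        ring
      have h3 : 0 ≤ w ω * ((r ω / M - 1) - (Real.log (r ω) - Real.log M)) / Real.log 2 := by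
        apply div_nonneg _ hl2.le
        apply mul_nonneg h0.le
        linarith
      linarith
  calc ∑ ω, w ω * Real.logb 2 (r ω)
      ≤ ∑ ω, (w ω * Real.logb 2 M + (w ω * r ω / M - w ω) / Real.log 2) :=
        Finset.sum_le_sum fun ω _ => key ω
    _ = Real.logb 2 M + ((∑ ω, w ω * r ω) / M - 1) / Real.log 2 := by
        rw [Finset.sum_add_distrib, ← Finset.sum_mul, h1, ← Finset.sum_div,
          Finset.sum_sub_distrib, h1, ← Finset.sum_div, one_mul]
    _ ≤ Real.logb 2 M := by
        have : (∑ ω, w ω * r ω) / M ≤ 1 := by rw [div_le_one hM]; exact hs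
        have : ((∑ ω, w ω * r ω) / M - 1) / Real.log 2 ≤ 0 :=
          div_nonpos_of_nonpos_of_nonneg (by linarith) hl2.le
        linarith

theorem sum_pair {n : ℕ} {A B : Type*} [Fintype A] [Fintype B] (F : (Fin n → A × B) → ℝ) :
    ∑ ω, F ω = ∑ x1 : Fin n → A, ∑ x2 : Fin n → B, F (fun t => (x1 t, x2 t)) := by
  rw [← Fintype.sum_prod_type' (f := fun (x1 : Fin n → A) (x2 : Fin n → B) =>
    F (fun t => (x1 t, x2 t)))]
  exact Fintype.sum_equiv (Equiv.arrowProdEquivProdArrow (Fin n) (fun _ => A) (fun _ => B)) _ _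
    (fun ω => rfl)

theorem sum_fiber {α β : Type*} [Fintype α] [Fintype β] (F : α → β → ℝ)
    (hF : ∀ x j, 0 ≤ F x j) (j : α → β) : ∑ x, F x (j x) ≤ ∑ j, ∑ x, F x j := by
  rw [Finset.sum_comm]
  exact Finset.sum_le_sum fun x _ =>
    Finset.single_le_sum (f := fun y => F x y) (fun y _ => hF x y) (Finset.mem_univ (j x))

theorem dist_nonneg' {Ω : Type*} [Fintype Ω] (w : Ω → ℝ) (hw : ∀ ω, 0 ≤ w ω)
    {α : Type*} [Fintype α] (X : Ω → α) (a : α) : 0 ≤ IT.dist w X a := by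
  unfold IT.dist
  refine Finset.sum_nonneg fun ω _ => ?_
  split_ifs
  · exact hw ω
  · exact le_rfl

theorem le_dist {Ω : Type*} [Fintype Ω] (w : Ω → ℝ) (hw : ∀ ω, 0 ≤ w ω)
    {α : Type*} [Fintype α] (X : Ω → α) (ω : Ω) : w ω ≤ IT.dist w X (X ω) := by
  classical
  unfold IT.dist
  refine le_trans ?_ (Finset.single_le_sum (fun ω' _ => ?_) (Finset.mem_univ ω))
  · simp
  · split_ifs
    · exact hw ω'
    · exact le_rfl

variable {A B C : Type*} [Fintype A] [Fintype B] [Fintype C]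

theorem iidW_nonneg {α : Type*} (p : α → ℝ) (hp : ∀ a, 0 ≤ p a) (n : ℕ) (ω : Fin n → α) :
    0 ≤ iidW p n ω := Finset.prod_nonneg fun _ _ => hp _

theorem sum_iidW {α : Type*} [Fintype α] (p : α → ℝ) (hp : IsPMF p) (n : ℕ) :
    ∑ ω, iidW p n ω = 1 := sum_prodW p hp.2

/-- time-averaged joint distribution -/
def qbar (p : A × B → ℝ) (n : ℕ) (Z : (Fin n → A × B) → Fin n → C) (v : A × B × C) : ℝ :=
  (1 / (n : ℝ)) * ∑ t, IT.dist (iidW p n) (fun ω => ((ω t).1, (ω t).2, Z ω t)) v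


theorem sum_qbar (p : A × B → ℝ) (n : ℕ) (Z : (Fin n → A × B) → Fin n → C)
    (φ : A × B × C → ℝ) :
    ∑ v, qbar p n Z v * φ v =
      (1 / (n : ℝ)) * ∑ t, ∑ ω, iidW p n ω * φ ((ω t).1, (ω t).2, Z ω t) := by
  unfold qbar
  simp_rw [mul_assoc, ← Finset.mul_sum, Finset.sum_mul]
  rw [Finset.sum_comm]
  simp_rw [sum_dist]

theorem qbar_nonneg (p : A × B → ℝ) (hp : IsPMF p) (n : ℕ) (Z : (Fin n → A × B) → Fin n → C)
    (v) : 0 ≤ qbar p n Z v := by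
  unfold qbar IT.dist
  refine mul_nonneg (by positivity) (Finset.sum_nonneg fun t _ => Finset.sum_nonneg fun ω _ => ?_)
  split_ifs
  · exact iidW_nonneg p hp.1 n ω
  · exact le_rfl

theorem qbar_pos (p : A × B → ℝ) (hp : IsPMF p) (n : ℕ) (hn : 0 < n) (Z : (Fin n → A × B) → Fin n → C)
    (ω : Fin n → A × B) (hω : 0 < iidW p n ω) (t : Fin n) :
    0 < qbar p n Z ((ω t).1, (ω t).2, Z ω t) := by
  unfold qbar
  have hn' : (0 : ℝ) < n := by exact_mod_cast hn
  refine mul_pos (by positivity) ?_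
  refine lt_of_lt_of_le hω ?_
  refine le_trans (le_dist (iidW p n) (iidW_nonneg p hp.1 n)
    (fun ω => ((ω t).1, (ω t).2, Z ω t)) ω) ?_
  exact Finset.single_le_sum (f := fun s => IT.dist (iidW p n)
    (fun ω => ((ω s).1, (ω s).2, Z ω s)) ((ω t).1, (ω t).2, Z ω t))
    (fun s _ => dist_nonneg' _ (iidW_nonneg p hp.1 n) _ _) (Finset.mem_univ t)

theorem qbar_marg (p : A × B → ℝ) (hp : IsPMF p) (n : ℕ) (hn : 0 < n) (Z : (Fin n → A × B) → Fin n → C)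
    (a : A) (b : B) : ∑ c, qbar p n Z (a, b, c) = p (a, b) := by
  classical
  have hn' : (0 : ℝ) < n := by exact_mod_cast hn
  have h := sum_qbar p n Z (fun v => if (v.1, v.2.1) = (a, b) then 1 else 0)
  have h2 : ∀ t : Fin n, ∑ ω, iidW p n ω * (if ((ω t).1, (ω t).2) = (a, b) then (1 : ℝ) else 0)
      = p (a, b) := by
    intro t
    have := marg_prodW p hp.2 t (fun x => if x = (a, b) then (1 : ℝ) else 0)
    unfold iidW
    simpa using this
  simp only [h2] at h
  rw [Finset.sum_const, Finset.card_univ, Fintype.card_fin, nsmul_eq_mul, ← mul_assoc,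
    one_div_mul_cancel hn'.ne', one_mul] at h
  rw [← h, Fintype.sum_prod_type, Finset.sum_eq_single a, Fintype.sum_prod_type,
    Finset.sum_eq_single b]
  · simp
  · intro b' _ hb; simp [hb]
  · simp
  · intro b' _ hb; simp [hb]
  · simp

theorem Elog_prod (p : A × B → ℝ) (hp : IsPMF p) (n : ℕ) (hn : 0 < n) (Z : (Fin n → A × B) → Fin n → C)
    (ρ : A × B × C → ℝ) (hρ : ∀ v, 0 < qbar p n Z v → 0 < ρ v) :
    ∑ ω, iidW p n ω * Real.logb 2 (∏ t, ρ ((ω t).1, (ω t).2, Z ω t)) =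
      n * ∑ v, qbar p n Z v * Real.logb 2 (ρ v) := by
  have hn' : (0 : ℝ) < n := by exact_mod_cast hn
  rw [sum_qbar, ← mul_assoc, mul_one_div_cancel hn'.ne', one_mul, Finset.sum_comm]
  refine Finset.sum_congr rfl fun ω _ => ?_
  rw [← Finset.mul_sum]
  rcases (iidW_nonneg p hp.1 n ω).eq_or_lt with h0 | h0
  · simp [← h0]
  · rw [Real.logb_prod]
    intro t _
    exact (hρ _ (qbar_pos p hp n hn Z ω h0 t)).ne'

/-- backward channel -/
def kch (q : A × B × C → ℝ) (v : A × B × C) : ℝ := q v / mg13 q v.1 v.2.2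

theorem kch_nonneg (q : A × B × C → ℝ) (hq : ∀ v, 0 ≤ q v) (v) : 0 ≤ kch q v :=
  div_nonneg (hq v) (Finset.sum_nonneg fun _ _ => hq _)

theorem sum_kch (q : A × B × C → ℝ) (a : A) (c : C) : ∑ b, kch q (a, b, c) ≤ 1 := by
  unfold kch
  simp only
  rw [← Finset.sum_div]
  exact div_self_le_one _

theorem sum_prod_kch (n : ℕ) (q : A × B × C → ℝ) (hq : ∀ v, 0 ≤ q v) (x1 : Fin n → A) (c : Fin n → C) :
    ∑ x2 : Fin n → B, ∏ t, kch q (x1 t, x2 t, c t) ≤ 1 := by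
  rw [sum_prod_pi (fun t b => kch q (x1 t, b, c t))]
  exact Finset.prod_le_one (fun t _ => Finset.sum_nonneg fun b _ => kch_nonneg q hq _)
    fun t _ => sum_kch q _ _

theorem kch_pos (q : A × B × C → ℝ) (hq : ∀ v, 0 ≤ q v) (v) (hv : 0 < q v) : 0 < kch q v :=
  div_pos hv (hv.trans_le (le_mg13 q hq v))

theorem W_mul_prod (p : A × B → ℝ) (n : ℕ) (Z : (Fin n → A × B) → Fin n → C)
     (ω : Fin n → A × B) (ρ σ : A × B × C → ℝ)
    (h : ∀ v, p (v.1, v.2.1) ≠ 0 → p (v.1, v.2.1) * ρ v = σ v) (hσ : ∀ v, 0 ≤ σ v) :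
    iidW p n ω * ∏ t, ρ ((ω t).1, (ω t).2, Z ω t) ≤ ∏ t, σ ((ω t).1, (ω t).2, Z ω t) := by
  by_cases h0 : ∃ t, p (ω t) = 0
  · obtain ⟨t, ht⟩ := h0
    rw [iidW, Finset.prod_eq_zero (Finset.mem_univ t) ht, zero_mul]
    exact Finset.prod_nonneg fun _ _ => hσ _
  · push Not at h0
    rw [iidW, ← Finset.prod_mul_distrib]
    exact (Finset.prod_congr rfl fun t _ =>
      h ((ω t).1, (ω t).2, Z ω t) (h0 t)).le

theorem sum_mg1 (p : A × B → ℝ) (hp : IsPMF p) : ∑ a, mg1 p a = 1 := by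
  unfold mg1; rw [← hp.2, Fintype.sum_prod_type]

theorem sum_mg2 (p : A × B → ℝ) (hp : IsPMF p) : ∑ a, mg2 p a = 1 := by
  unfold mg2; rw [← hp.2, Fintype.sum_prod_type, Finset.sum_comm]

end Converse


section Converse2

open Classical in
/-- smoothed guess kernel used in place of Fano's inequality -/
def guess {α : Type*} [Fintype α] (ε : ℝ) (g x : α) : ℝ :=
  (1 - ε) * (if x = g then 1 else 0) + ε / Fintype.card α

theorem guess_pos {α : Type*} [Fintype α] [Nonempty α] (ε : ℝ) (h0 : 0 < ε) (h1 : ε < 1)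
    (g x : α) : 0 < guess ε g x := by
  have : (0 : ℝ) < Fintype.card α := by exact_mod_cast Fintype.card_pos
  unfold guess
  have h2 : 0 < ε / Fintype.card α := by positivity
  split_ifs <;> nlinarith

theorem sum_guess {α : Type*} [Fintype α] [Nonempty α] (ε : ℝ) (g : α) :
    ∑ x, guess ε g x = 1 := by
  classical
  have : (0 : ℝ) < Fintype.card α := by exact_mod_cast Fintype.card_pos
  unfold guess
  rw [Finset.sum_add_distrib, ← Finset.mul_sum]
  simp
  field_simp
  ring

theorem Elog_guess {Ω : Type*} [Fintype Ω] (w : Ω → ℝ) (hw : ∀ ω, 0 ≤ w ω) (hw1 : ∑ ω, w ω = 1)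
    {α : Type*} [Fintype α] [Nonempty α] (ε : ℝ) (h0 : 0 < ε) (h1 : ε < 1)
    (G X : Ω → α) (he : IT.pr w (fun ω => G ω ≠ X ω) ≤ ε) :
    Real.logb 2 (1 - ε) + ε * Real.logb 2 ε - ε * Real.logb 2 (Fintype.card α) ≤
      ∑ ω, w ω * Real.logb 2 (guess ε (G ω) (X ω)) := by
  classical
  have hc : (1 : ℝ) ≤ Fintype.card α := by exact_mod_cast Fintype.card_pos
  have hc0 : (0 : ℝ) < Fintype.card α := by linarith
  set M : ℝ := (Fintype.card α : ℝ) with hM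
  have hle : Real.logb 2 (ε / M) ≤ 0 := by
    apply Real.logb_nonpos (by norm_num) (by positivity)
    rw [div_le_one hc0]; linarith
  have hle1 : Real.logb 2 (1 - ε) ≤ 0 :=
    Real.logb_nonpos (by norm_num) (by linarith) (by linarith)
  have key : ∀ ω, w ω * Real.logb 2 (1 - ε) + (if G ω ≠ X ω then w ω else 0) * Real.logb 2 (ε / M) ≤
      w ω * Real.logb 2 (guess ε (G ω) (X ω)) := by
    intro ω
    by_cases h : G ω = X ω
    · simp only [h, ne_eq, not_true_eq_false, if_false, zero_mul, add_zero]
      apply mul_le_mul_of_nonneg_left _ (hw ω)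
      apply Real.logb_le_logb_of_le (by norm_num) (by linarith)
      unfold guess
      have : 0 ≤ ε / Fintype.card α := by positivity
      simp; positivity
    · simp only [ne_eq, h, not_false_eq_true, if_true]
      rw [← mul_add]
      apply mul_le_mul_of_nonneg_left _ (hw ω)
      have : guess ε (G ω) (X ω) = ε / M := by
        unfold guess
        rw [if_neg (fun h' => h h'.symm)]; simp [hM]
      rw [this]; linarith
  have := Finset.sum_le_sum fun ω (_ : ω ∈ Finset.univ) => key ω
  rw [Finset.sum_add_distrib, ← Finset.sum_mul, hw1, one_mul, ← Finset.sum_mul] at this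
  have he' : ∑ ω, (if G ω ≠ X ω then w ω else 0) ≤ ε := by
    refine le_trans (le_of_eq ?_) he
    unfold IT.pr
    refine Finset.sum_congr rfl fun ω _ => ?_
    congr
  have h3 := mul_le_mul_of_nonpos_right he' hle
  rw [Real.logb_div h0.ne' hc0.ne'] at *
  nlinarith

variable {A B C : Type*} [Fintype A] [Fintype B] [Fintype C]

theorem info_eq' (q : A × B × C → ℝ) (hq : ∀ v, 0 ≤ q v)
    (p : A × B → ℝ) (h : ∀ a b, (∑ c, q (a, b, c)) = p (a, b)) :
    info q p = ∑ v, q v * Real.logb 2 (kch q v / (p (v.1, v.2.1) / mg1 p v.1)) := by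
  unfold info
  refine Finset.sum_congr rfl fun v _ => ?_
  rcases (hq v).eq_or_lt with h0 | h0
  · simp [← h0]
  · have h1 := h0.trans_le (le_marg q hq p h v)
    have h2 := h1.trans_le (le_mg1 p (marg_nonneg q hq p h) _)
    have h3 := kch_pos q hq v h0
    rw [Real.logb_div h3.ne' (div_pos h1 h2).ne']
    rfl

theorem info_add_eq (q : A × B × C → ℝ) (hq : ∀ v, 0 ≤ q v)
    (p : A × B → ℝ) (h : ∀ a b, (∑ c, q (a, b, c)) = p (a, b)) :
    hX1 p + info q p = ∑ v, q v * Real.logb 2 (kch q v / p (v.1, v.2.1)) := by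
  unfold info hX1
  rw [← sum_marg q p h, ← Finset.sum_neg_distrib, ← Finset.sum_add_distrib]
  refine Finset.sum_congr rfl fun v _ => ?_
  rcases (hq v).eq_or_lt with h0 | h0
  · simp [← h0]
  · have h1 := h0.trans_le (le_marg q hq p h v)
    have h2 := h1.trans_le (le_mg1 p (marg_nonneg q hq p h) _)
    have h3 := kch_pos q hq v h0
    rw [Real.logb_div h3.ne' h1.ne', Real.logb_div h1.ne' h2.ne']
    unfold kch
    ring

theorem hX1X2_eq (q : A × B × C → ℝ)
    (p : A × B → ℝ) (h : ∀ a b, (∑ c, q (a, b, c)) = p (a, b)) :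
    hX1X2 p = ∑ v, q v * Real.logb 2 (mg2 p v.2.1 / p (v.1, v.2.1)) := by
  unfold hX1X2
  rw [← sum_marg q p h (fun x => Real.logb 2 (p x / mg2 p x.2)), ← Finset.sum_neg_distrib]
  refine Finset.sum_congr rfl fun v _ => ?_
  rw [← mul_neg, ← Real.logb_inv, inv_div]

variable (p : A × B → ℝ) (n : ℕ) {𝒥₁ 𝒥₂ : Type*} [Fintype 𝒥₁] [Fintype 𝒥₂]
    (J1 : (Fin n → A × B) → 𝒥₁) (J2 : (Fin n → A × B) → 𝒥₂)
    (F1 : (Fin n → A) → 𝒥₂ → 𝒥₁) (F2 : (Fin n → B) → 𝒥₁ → 𝒥₂)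
    (g1 : 𝒥₁ → 𝒥₂ → Fin n → A) (g2 : 𝒥₁ → 𝒥₂ → Fin n → C)

theorem conv_c (hp : IsPMF p) (hn : 0 < n) (hJ1 : ∀ ω, J1 ω = F1 (fun t => (ω t).1) (J2 ω)) :
    n * info (qbar p n fun ω => g2 (J1 ω) (J2 ω)) p ≤ Real.logb 2 (Fintype.card 𝒥₂) := by
  classical
  set Z := fun ω => g2 (J1 ω) (J2 ω) with hZ
  set q := qbar p n Z with hq'
  have hq : ∀ v, 0 ≤ q v := qbar_nonneg p hp n Z
  have hm := qbar_marg p hp n hn Z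
  have : Nonempty (A × B) := by
    by_contra hne
    rw [not_nonempty_iff] at hne
    have := hp.2
    simp at this
  have : Nonempty 𝒥₂ := ⟨J2 (fun _ => Classical.arbitrary _)⟩
  have hpos : ∀ v, 0 < q v → 0 < kch q v / (p (v.1, v.2.1) / mg1 p v.1) := by
    intro v h0
    have h1 := h0.trans_le (le_marg q hq p hm v)
    have h2 := h1.trans_le (le_mg1 p hp.1 _)
    exact div_pos (kch_pos q hq v h0) (div_pos h1 h2)
  have hm1 : ∀ a, 0 ≤ mg1 p a := fun a => Finset.sum_nonneg fun _ _ => hp.1 _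
  rw [info_eq' q hq p hm, ← Elog_prod p hp n hn Z _ hpos]
  refine gibbs _ _ (iidW_nonneg p hp.1 n) (sum_iidW p hp n) ?_ _
    (by exact_mod_cast Fintype.card_pos) ?_
  · intro ω hω
    exact Finset.prod_pos fun t _ => hpos _ (qbar_pos p hp n hn Z ω hω t)
  · calc _ ≤ ∑ ω : Fin n → A × B, ∏ t, (fun v => mg1 p v.1 * kch q v) ((ω t).1, (ω t).2, Z ω t) := by
          refine Finset.sum_le_sum fun ω _ => W_mul_prod p n Z ω
            (fun v => kch q v / (p (v.1, v.2.1) / mg1 p v.1))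
            (fun v => mg1 p v.1 * kch q v) ?_ ?_
          · intro v hv
            have h1 : 0 < p (v.1, v.2.1) := lt_of_le_of_ne (hp.1 _) hv.symm
            have h2 := h1.trans_le (le_mg1 p hp.1 _)
            simp only at h2 ⊢
            field_simp
          · intro v
            exact mul_nonneg (hm1 _) (kch_nonneg q hq v)
      _ = ∑ x1 : Fin n → A, ∑ x2 : Fin n → B, (fun x2 j => (∏ t, mg1 p (x1 t)) *
            ∏ t, kch q (x1 t, x2 t, g2 (F1 x1 j) j t)) x2 (J2 fun t => (x1 t, x2 t)) := by
          rw [sum_pair]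
          refine Finset.sum_congr rfl fun x1 _ => Finset.sum_congr rfl fun x2 _ => ?_
          simp only [hZ, hJ1, Finset.prod_mul_distrib]
      _ ≤ ∑ x1 : Fin n → A, ∑ j, ∑ x2 : Fin n → B, (∏ t, mg1 p (x1 t)) *
            ∏ t, kch q (x1 t, x2 t, g2 (F1 x1 j) j t) := by
          refine Finset.sum_le_sum fun x1 _ => sum_fiber (fun (x2 : Fin n → B) (j : 𝒥₂) => (∏ t, mg1 p (x1 t)) *
            ∏ t, kch q (x1 t, x2 t, g2 (F1 x1 j) j t)) (fun x2 j => ?_)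
            (fun x2 => J2 fun t => (x1 t, x2 t))
          exact mul_nonneg (Finset.prod_nonneg fun _ _ => hm1 _)
            (Finset.prod_nonneg fun _ _ => kch_nonneg q hq _)
      _ ≤ ∑ x1 : Fin n → A, ∑ j : 𝒥₂, ∏ t, mg1 p (x1 t) := by
          refine Finset.sum_le_sum fun x1 _ => Finset.sum_le_sum fun j _ => ?_
          rw [← Finset.mul_sum]
          exact mul_le_of_le_one_right (Finset.prod_nonneg fun _ _ => hm1 _)
            (sum_prod_kch n q hq _ _)
      _ = Fintype.card 𝒥₂ := by
          simp only [Finset.sum_const, ← Finset.smul_sum]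
          rw [sum_prodW (mg1 p) (sum_mg1 p hp)]
          simp

theorem conv_b (hp : IsPMF p) (hn : 0 < n) (ε : ℝ) (h0 : 0 < ε) (h1 : ε < 1)
    (he : IT.pr (iidW p n) (fun ω => g1 (J1 ω) (J2 ω) ≠ fun t => (ω t).1) ≤ ε) :
    n * (hX1 p + info (qbar p n fun ω => g2 (J1 ω) (J2 ω)) p) ≤
      Real.logb 2 (Fintype.card 𝒥₁) + Real.logb 2 (Fintype.card 𝒥₂)
      - (Real.logb 2 (1 - ε) + ε * Real.logb 2 ε - ε * (n * Real.logb 2 (Fintype.card A))) := by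
  classical
  set Z := fun ω => g2 (J1 ω) (J2 ω) with hZ
  set q := qbar p n Z with hq'
  have hq : ∀ v, 0 ≤ q v := qbar_nonneg p hp n Z
  have hm := qbar_marg p hp n hn Z
  have : Nonempty (A × B) := by
    by_contra hne
    rw [not_nonempty_iff] at hne
    have := hp.2
    simp at this
  have : Nonempty A := ⟨(Classical.arbitrary (A × B)).1⟩
  have : Nonempty 𝒥₂ := ⟨J2 (fun _ => Classical.arbitrary _)⟩
  have : Nonempty 𝒥₁ := ⟨J1 (fun _ => Classical.arbitrary _)⟩
  have hpos : ∀ v, 0 < q v → 0 < kch q v / p (v.1, v.2.1) := by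
    intro v h0
    have h1 := h0.trans_le (le_marg q hq p hm v)
    exact div_pos (kch_pos q hq v h0) h1
  have hG := Elog_guess (iidW p n) (iidW_nonneg p hp.1 n) (sum_iidW p hp n) ε h0 h1
    (fun ω => g1 (J1 ω) (J2 ω)) (fun ω t => (ω t).1) he
  have hcard : Real.logb 2 (Fintype.card (Fin n → A)) = n * Real.logb 2 (Fintype.card A) := by
    rw [Fintype.card_fun, Fintype.card_fin]
    push_cast
    rw [Real.logb_pow]
  rw [hcard] at hG
  have hc1 : (0 : ℝ) < Fintype.card 𝒥₁ := by exact_mod_cast Fintype.card_pos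
  have hc2 : (0 : ℝ) < Fintype.card 𝒥₂ := by exact_mod_cast Fintype.card_pos
  rw [info_add_eq q hq p hm, ← Elog_prod p hp n hn Z _ hpos]
  have hprod : ∀ ω, 0 < iidW p n ω → 0 < ∏ t, (fun v => kch q v / p (v.1, v.2.1))
      ((ω t).1, (ω t).2, Z ω t) := fun ω hω =>
    Finset.prod_pos fun t _ => hpos _ (qbar_pos p hp n hn Z ω hω t)
  have hgi := gibbs (iidW p n) (fun ω => (∏ t, (fun v => kch q v / p (v.1, v.2.1))
      ((ω t).1, (ω t).2, Z ω t)) * guess ε (g1 (J1 ω) (J2 ω)) (fun t => (ω t).1))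
    (iidW_nonneg p hp.1 n) (sum_iidW p hp n)
    (fun ω hω => mul_pos (hprod ω hω) (guess_pos ε h0 h1 _ _))
    (Fintype.card 𝒥₁ * Fintype.card 𝒥₂) (by positivity) ?_
  · rw [Real.logb_mul hc1.ne' hc2.ne'] at hgi
    have : ∑ ω, iidW p n ω * Real.logb 2 ((∏ t, (fun v => kch q v / p (v.1, v.2.1))
      ((ω t).1, (ω t).2, Z ω t)) * guess ε (g1 (J1 ω) (J2 ω)) (fun t => (ω t).1)) =
      ∑ ω, iidW p n ω * Real.logb 2 (∏ t, (fun v => kch q v / p (v.1, v.2.1))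
      ((ω t).1, (ω t).2, Z ω t)) +
      ∑ ω, iidW p n ω * Real.logb 2 (guess ε (g1 (J1 ω) (J2 ω)) (fun t => (ω t).1)) := by
      rw [← Finset.sum_add_distrib]
      refine Finset.sum_congr rfl fun ω _ => ?_
      rcases (iidW_nonneg p hp.1 n ω).eq_or_lt with h | h
      · simp [← h]
      · rw [Real.logb_mul (hprod ω h).ne' (guess_pos ε h0 h1 _ _).ne']
        ring
    linarith
  · calc _ ≤ ∑ ω : Fin n → A × B, (∏ t, kch q ((ω t).1, (ω t).2, Z ω t)) *
            guess ε (g1 (J1 ω) (J2 ω)) (fun t => (ω t).1) := by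
          refine Finset.sum_le_sum fun ω _ => ?_
          rw [← mul_assoc]
          refine mul_le_mul_of_nonneg_right ?_ (guess_pos ε h0 h1 _ _).le
          refine W_mul_prod p n Z ω (fun v => kch q v / p (v.1, v.2.1))
            (kch q) ?_ (kch_nonneg q hq)
          intro v hv
          field_simp
      _ = ∑ x1 : Fin n → A, ∑ x2 : Fin n → B, (fun x2 (j : 𝒥₁ × 𝒥₂) =>
            guess ε (g1 j.1 j.2) x1 * ∏ t, kch q (x1 t, x2 t, g2 j.1 j.2 t)) x2
            (J1 fun t => (x1 t, x2 t), J2 fun t => (x1 t, x2 t)) := by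
          rw [sum_pair]
          refine Finset.sum_congr rfl fun x1 _ => Finset.sum_congr rfl fun x2 _ => ?_
          rw [mul_comm]
      _ ≤ ∑ x1 : Fin n → A, ∑ j : 𝒥₁ × 𝒥₂, ∑ x2 : Fin n → B,
            guess ε (g1 j.1 j.2) x1 * ∏ t, kch q (x1 t, x2 t, g2 j.1 j.2 t) := by
          refine Finset.sum_le_sum fun x1 _ => sum_fiber (fun (x2 : Fin n → B) (j : 𝒥₁ × 𝒥₂) =>
            guess ε (g1 j.1 j.2) x1 * ∏ t, kch q (x1 t, x2 t, g2 j.1 j.2 t)) (fun x2 j => ?_)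
            (fun x2 => (J1 fun t => (x1 t, x2 t), J2 fun t => (x1 t, x2 t)))
          exact mul_nonneg (guess_pos ε h0 h1 _ _).le
            (Finset.prod_nonneg fun _ _ => kch_nonneg q hq _)
      _ ≤ ∑ x1 : Fin n → A, ∑ j : 𝒥₁ × 𝒥₂, guess ε (g1 j.1 j.2) x1 := by
          refine Finset.sum_le_sum fun x1 _ => Finset.sum_le_sum fun j _ => ?_
          rw [← Finset.mul_sum]
          exact mul_le_of_le_one_right (guess_pos ε h0 h1 _ _).le
            (sum_prod_kch n q hq _ _)
      _ = Fintype.card 𝒥₁ * Fintype.card 𝒥₂ := by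
          rw [Finset.sum_comm]
          simp only [sum_guess]
          simp

theorem conv_a (hp : IsPMF p) (hn : 0 < n) (ε : ℝ) (h0 : 0 < ε) (h1 : ε < 1)
    (hJ2 : ∀ ω, J2 ω = F2 (fun t => (ω t).2) (J1 ω))
    (he : IT.pr (iidW p n) (fun ω => g1 (J1 ω) (J2 ω) ≠ fun t => (ω t).1) ≤ ε) :
    n * hX1X2 p ≤ Real.logb 2 (Fintype.card 𝒥₁)
      - (Real.logb 2 (1 - ε) + ε * Real.logb 2 ε - ε * (n * Real.logb 2 (Fintype.card A))) := by
  classical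
  set Z : (Fin n → A × B) → Fin n → Unit := fun ω t => () with hZ
  set q := qbar p n Z with hq'
  have hq : ∀ v, 0 ≤ q v := qbar_nonneg p hp n Z
  have hm := qbar_marg p hp n hn Z
  have : Nonempty (A × B) := by
    by_contra hne
    rw [not_nonempty_iff] at hne
    have := hp.2
    simp at this
  have : Nonempty A := ⟨(Classical.arbitrary (A × B)).1⟩
  have : Nonempty 𝒥₁ := ⟨J1 (fun _ => Classical.arbitrary _)⟩
  have hm2 : ∀ a, 0 ≤ mg2 p a := fun a => Finset.sum_nonneg fun _ _ => hp.1 _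
  have hpos : ∀ v, 0 < q v → 0 < mg2 p v.2.1 / p (v.1, v.2.1) := by
    intro v h0
    have h1 := h0.trans_le (le_marg q hq p hm v)
    have h2 := h1.trans_le (le_mg2 p hp.1 _)
    exact div_pos h2 h1
  have hG := Elog_guess (iidW p n) (iidW_nonneg p hp.1 n) (sum_iidW p hp n) ε h0 h1
    (fun ω => g1 (J1 ω) (J2 ω)) (fun ω t => (ω t).1) he
  have hcard : Real.logb 2 (Fintype.card (Fin n → A)) = n * Real.logb 2 (Fintype.card A) := by
    rw [Fintype.card_fun, Fintype.card_fin]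
    push_cast
    rw [Real.logb_pow]
  rw [hcard] at hG
  have hc1 : (0 : ℝ) < Fintype.card 𝒥₁ := by exact_mod_cast Fintype.card_pos
  rw [hX1X2_eq q p hm, ← Elog_prod p hp n hn Z _ hpos]
  have hprod : ∀ ω, 0 < iidW p n ω → 0 < ∏ t, (fun v => mg2 p v.2.1 / p (v.1, v.2.1))
      ((ω t).1, (ω t).2, Z ω t) := fun ω hω =>
    Finset.prod_pos fun t _ => hpos _ (qbar_pos p hp n hn Z ω hω t)
  have hgi := gibbs (iidW p n) (fun ω => (∏ t, (fun v => mg2 p v.2.1 / p (v.1, v.2.1))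
      ((ω t).1, (ω t).2, Z ω t)) * guess ε (g1 (J1 ω) (J2 ω)) (fun t => (ω t).1))
    (iidW_nonneg p hp.1 n) (sum_iidW p hp n)
    (fun ω hω => mul_pos (hprod ω hω) (guess_pos ε h0 h1 _ _))
    (Fintype.card 𝒥₁) (by positivity) ?_
  · have : ∑ ω, iidW p n ω * Real.logb 2 ((∏ t, (fun v => mg2 p v.2.1 / p (v.1, v.2.1))
      ((ω t).1, (ω t).2, Z ω t)) * guess ε (g1 (J1 ω) (J2 ω)) (fun t => (ω t).1)) =
      ∑ ω, iidW p n ω * Real.logb 2 (∏ t, (fun v => mg2 p v.2.1 / p (v.1, v.2.1))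
      ((ω t).1, (ω t).2, Z ω t)) +
      ∑ ω, iidW p n ω * Real.logb 2 (guess ε (g1 (J1 ω) (J2 ω)) (fun t => (ω t).1)) := by
      rw [← Finset.sum_add_distrib]
      refine Finset.sum_congr rfl fun ω _ => ?_
      rcases (iidW_nonneg p hp.1 n ω).eq_or_lt with h | h
      · simp [← h]
      · rw [Real.logb_mul (hprod ω h).ne' (guess_pos ε h0 h1 _ _).ne']
        ring
    linarith
  · calc _ ≤ ∑ ω : Fin n → A × B, (∏ t, (fun v : A × B × Unit => mg2 p v.2.1)
            ((ω t).1, (ω t).2, Z ω t)) * guess ε (g1 (J1 ω) (J2 ω)) (fun t => (ω t).1) := by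
          refine Finset.sum_le_sum fun ω _ => ?_
          rw [← mul_assoc]
          refine mul_le_mul_of_nonneg_right ?_ (guess_pos ε h0 h1 _ _).le
          refine W_mul_prod p n Z ω (fun v => mg2 p v.2.1 / p (v.1, v.2.1))
            (fun v => mg2 p v.2.1) ?_ (fun v => hm2 _)
          intro v hv
          field_simp
      _ = ∑ x2 : Fin n → B, ∑ x1 : Fin n → A, (fun x1 (j : 𝒥₁) => (∏ t, mg2 p (x2 t)) *
            guess ε (g1 j (F2 x2 j)) x1) x1 (J1 fun t => (x1 t, x2 t)) := by
          rw [sum_pair, Finset.sum_comm]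
          refine Finset.sum_congr rfl fun x2 _ => Finset.sum_congr rfl fun x1 _ => ?_
          simp only [hJ2]
      _ ≤ ∑ x2 : Fin n → B, ∑ j : 𝒥₁, ∑ x1 : Fin n → A, (∏ t, mg2 p (x2 t)) *
            guess ε (g1 j (F2 x2 j)) x1 := by
          refine Finset.sum_le_sum fun x2 _ => sum_fiber (fun (x1 : Fin n → A) (j : 𝒥₁) => (∏ t, mg2 p (x2 t)) *
            guess ε (g1 j (F2 x2 j)) x1) (fun x1 j => ?_)
            (fun x1 => J1 fun t => (x1 t, x2 t))
          exact mul_nonneg (Finset.prod_nonneg fun _ _ => hm2 _) (guess_pos ε h0 h1 _ _).le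
      _ = Fintype.card 𝒥₁ := by
          simp only [← Finset.mul_sum, sum_guess, Finset.sum_const, ← Finset.sum_mul]
          rw [sum_prodW (mg2 p) (sum_mg2 p hp)]
          simp

end Converse2


/-! ### Support reduction and compactness -/

section Support

variable {A B C Y : Type*} [Fintype A] [Fintype B] [Fintype C]

theorem info_slices (q : A × B × C → ℝ)
    (p : A × B → ℝ) (h : ∀ a b, (∑ c, q (a, b, c)) = p (a, b)) :
    info q p = ∑ c, (∑ x : A × B, q (x.1, x.2, c) * Real.logb 2 (kch q (x.1, x.2, c)))
      - ∑ x, p x * Real.logb 2 (p x / mg1 p x.1) := by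
  unfold info
  simp_rw [mul_sub]
  rw [Finset.sum_sub_distrib, sum_marg q p h (fun x => Real.logb 2 (p x / mg1 p x.1)),
    Finset.sum_comm]
  congr 1
  rw [Fintype.sum_prod_type, Fintype.sum_prod_type]
  refine Finset.sum_congr rfl fun a _ => ?_
  rw [Fintype.sum_prod_type]
  rfl

theorem expect_slices (q : A × B × C → ℝ) (φ : A × B × C → ℝ) :
    IT.expect q φ = ∑ c, ∑ x : A × B, q (x.1, x.2, c) * φ (x.1, x.2, c) := by
  unfold IT.expect
  rw [Finset.sum_comm, Fintype.sum_prod_type, Fintype.sum_prod_type]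
  refine Finset.sum_congr rfl fun a _ => ?_
  rw [Fintype.sum_prod_type]

theorem drop_step (d : B → Y → ℝ) (p : A × B → ℝ) (k : ℕ) (q : A × B × Fin (k + 1) → ℝ)
    (hq : ∀ v, 0 ≤ q v) (hm : ∀ a b, (∑ c, q (a, b, c)) = p (a, b))
    (g : A → Fin (k + 1) → Y) (s : Fin (k + 1) → ℝ) (hs : ∀ c, 0 ≤ s c) (cs : Fin (k + 1))
    (hcs : s cs = 0) (h1 : ∀ a b, ∑ c, s c * q (a, b, c) = p (a, b))
    (h2 : ∑ c, s c * (∑ x : A × B, q (x.1, x.2, c) * d x.2 (g x.1 c)) ≤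
      ∑ c, (∑ x : A × B, q (x.1, x.2, c) * d x.2 (g x.1 c)))
    (h3 : ∑ c, s c * (∑ x : A × B, q (x.1, x.2, c) * Real.logb 2 (kch q (x.1, x.2, c))) ≤
      ∑ c, (∑ x : A × B, q (x.1, x.2, c) * Real.logb 2 (kch q (x.1, x.2, c)))) :
    ∃ (q' : A × B × Fin k → ℝ), (∀ v, 0 ≤ q' v) ∧ (∀ a b, (∑ c, q' (a, b, c)) = p (a, b)) ∧
      ∃ g' : A → Fin k → Y,
      IT.expect q' (fun v => d v.2.1 (g' v.1 v.2.2)) ≤ IT.expect q (fun v => d v.2.1 (g v.1 v.2.2)) ∧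
      info q' p ≤ info q p := by
  have hm' : ∀ a b, (∑ c, s (cs.succAbove c) * q (a, b, cs.succAbove c)) = p (a, b) := by
    intro a b
    rw [← h1, Fin.sum_univ_succAbove _ cs, hcs]
    simp
  refine ⟨fun v => s (cs.succAbove v.2.2) * q (v.1, v.2.1, cs.succAbove v.2.2),
    fun v => mul_nonneg (hs _) (hq _), hm', fun a c => g a (cs.succAbove c), ?_, ?_⟩
  · rw [expect_slices, expect_slices]
    refine le_trans (le_of_eq ?_) h2
    rw [Fin.sum_univ_succAbove _ cs, hcs]
    simp [Finset.mul_sum, mul_assoc]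
  · rw [info_slices _ p hm', info_slices _ p hm]
    refine sub_le_sub_right (le_trans (le_of_eq ?_) h3) _
    rw [Fin.sum_univ_succAbove _ cs, hcs, zero_mul, zero_add]
    refine Finset.sum_congr rfl fun c _ => ?_
    rw [Finset.mul_sum]
    refine Finset.sum_congr rfl fun x _ => ?_
    rw [← mul_assoc]
    by_cases h0 : s (cs.succAbove c) = 0
    · simp [h0]
    · congr 2
      unfold kch mg13
      simp only
      rw [← Finset.mul_sum, mul_div_mul_left _ _ h0]

theorem lp_step {κ : Type*} [Fintype κ] (u : ℕ) (hu : Fintype.card κ < u) (v : Fin u → κ → ℝ)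
    (F : Fin u → ℝ) (m : (κ → ℝ) →ₗ[ℝ] ℝ) (hpos : ∀ c, 0 < m (v c)) :
    ∃ s : Fin u → ℝ, (∀ c, 0 ≤ s c) ∧ (∃ cs, s cs = 0) ∧
      (∀ i, ∑ c, s c * v c i = ∑ c, v c i) ∧ ∑ c, s c * F c ≤ ∑ c, F c := by
  classical
  obtain ⟨ν, hν0, hν, hF⟩ : ∃ ν : Fin u → ℝ, ν ≠ 0 ∧ (∑ c, ν c • v c = 0) ∧
      ∑ c, ν c * F c ≤ 0 := by
    have hk : LinearMap.ker (Fintype.linearCombination ℝ v) ≠ ⊥ := by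
      apply LinearMap.ker_ne_bot_of_finrank_lt
      simpa using hu
    obtain ⟨ν, hν, hν0⟩ := Submodule.exists_mem_ne_zero_of_ne_bot hk
    rw [LinearMap.mem_ker, Fintype.linearCombination_apply] at hν
    rcases le_total (∑ c, ν c * F c) 0 with h | h
    · exact ⟨ν, hν0, hν, h⟩
    · refine ⟨-ν, neg_ne_zero.mpr hν0, ?_, ?_⟩
      · simp [hν]
      · simpa using h
  have hsum : ∑ c, ν c * m (v c) = 0 := by
    have := congrArg m hν
    simpa using this
  obtain ⟨c0, hc0⟩ : ∃ c, ν c < 0 := by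
    by_contra hcon
    push Not at hcon
    apply hν0
    have := (Finset.sum_eq_zero_iff_of_nonneg
      (fun c _ => mul_nonneg (hcon c) (hpos c).le)).mp hsum
    funext c
    have h := this c (Finset.mem_univ c)
    rcases mul_eq_zero.mp h with h | h
    · exact h
    · exact absurd h (hpos c).ne'
  have : Nonempty (Fin u) := ⟨c0⟩
  obtain ⟨cs, hcs⟩ := Finite.exists_min ν
  have hneg : ν cs < 0 := (hcs c0).trans_lt hc0
  have ht : 0 < (-ν cs)⁻¹ := inv_pos.mpr (by linarith)
  refine ⟨fun c => 1 + (-ν cs)⁻¹ * ν c, fun c => ?_, ⟨cs, ?_⟩, fun i => ?_, ?_⟩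
  · have : (-ν cs)⁻¹ * ν cs ≤ (-ν cs)⁻¹ * ν c := mul_le_mul_of_nonneg_left (hcs c) ht.le
    have h2 : (-ν cs)⁻¹ * ν cs = -1 := by
      rw [inv_neg, neg_mul, inv_mul_cancel₀ hneg.ne]
    linarith
  · have := hneg.ne
    field_simp
    ring
  · simp only [add_mul, one_mul, Finset.sum_add_distrib, mul_assoc, ← Finset.mul_sum]
    have := congrFun hν i
    simp at this
    rw [this]; simp
  · simp only [add_mul, one_mul, Finset.sum_add_distrib, mul_assoc, ← Finset.mul_sum]
    nlinarith

theorem reduce_support (d : B → Y → ℝ) (p : A × B → ℝ) (u : ℕ) (q : A × B × Fin u → ℝ)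
    (hq : ∀ v, 0 ≤ q v) (hm : ∀ a b, (∑ c, q (a, b, c)) = p (a, b)) (g : A → Fin u → Y) :
    ∃ u' : ℕ, u' ≤ Fintype.card A * Fintype.card B + 1 ∧
    ∃ (q' : A × B × Fin u' → ℝ), (∀ v, 0 ≤ q' v) ∧ (∀ a b, (∑ c, q' (a, b, c)) = p (a, b)) ∧
      ∃ g' : A → Fin u' → Y,
      IT.expect q' (fun v => d v.2.1 (g' v.1 v.2.2)) ≤ IT.expect q (fun v => d v.2.1 (g v.1 v.2.2)) ∧
      info q' p ≤ info q p := by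
  classical
  induction u with
  | zero => exact ⟨0, by omega, q, hq, hm, g, le_rfl, le_rfl⟩
  | succ k ih =>
    by_cases hu : k + 1 ≤ Fintype.card A * Fintype.card B + 1
    · exact ⟨k + 1, hu, q, hq, hm, g, le_rfl, le_rfl⟩
    suffices h : ∃ (q' : A × B × Fin k → ℝ), (∀ v, 0 ≤ q' v) ∧
        (∀ a b, (∑ c, q' (a, b, c)) = p (a, b)) ∧
        ∃ g' : A → Fin k → Y,
        IT.expect q' (fun v => d v.2.1 (g' v.1 v.2.2)) ≤
          IT.expect q (fun v => d v.2.1 (g v.1 v.2.2)) ∧ info q' p ≤ info q p by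
      obtain ⟨q', hq', hm', g', h1, h2⟩ := h
      obtain ⟨u', hu', q'', a1, a2, g'', a3, a4⟩ := ih q' hq' hm' g'
      exact ⟨u', hu', q'', a1, a2, g'', a3.trans h1, a4.trans h2⟩
    by_cases hz : ∃ cs, ∀ x : A × B, q (x.1, x.2, cs) = 0
    · obtain ⟨cs, hz⟩ := hz
      refine drop_step d p k q hq hm g (fun c => if c = cs then 0 else 1) ?_ cs (by simp) ?_ ?_ ?_
      · intro c
        split_ifs <;> norm_num
      · intro a b
        rw [← hm]
        refine Finset.sum_congr rfl fun c _ => ?_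
        by_cases h : c = cs
        · subst h; simp [hz (a, b)]
        · simp [h]
      · refine le_of_eq (Finset.sum_congr rfl fun c _ => ?_)
        by_cases h : c = cs
        · subst h; simp [hz]
        · simp [h]
      · refine le_of_eq (Finset.sum_congr rfl fun c _ => ?_)
        by_cases h : c = cs
        · subst h; simp [hz]
        · simp [h]
    · push Not at hz
      obtain ⟨s, hs, ⟨cs, hcs⟩, h1, h3⟩ := lp_step (κ := Option (A × B)) (k + 1) (by
          rw [Fintype.card_option, Fintype.card_prod]; omega)
        (fun c i => i.elim (∑ x : A × B, q (x.1, x.2, c) * d x.2 (g x.1 c))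
          (fun x => q (x.1, x.2, c)))
        (fun c => ∑ x : A × B, q (x.1, x.2, c) * Real.logb 2 (kch q (x.1, x.2, c)))
        (∑ x : A × B, LinearMap.proj (some x)) (by
          intro c
          obtain ⟨x, hx⟩ := hz c
          simp only [LinearMap.sum_apply, LinearMap.proj_apply, Option.elim]
          refine Finset.sum_pos' (fun _ _ => hq _) ⟨x, Finset.mem_univ x, ?_⟩
          exact lt_of_le_of_ne (hq _) hx.symm)
      refine drop_step d p k q hq hm g s hs cs hcs ?_ ?_ h3
      · intro a b
        rw [← hm]
        exact h1 (some (a, b))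
      · exact (h1 none).le

theorem continuous_H {Ω : Type*} [Fintype Ω] {α : Type*} [Fintype α] (X : Ω → α) :
    Continuous (fun w : Ω → ℝ => IT.H w X) := by
  unfold IT.H
  refine (continuous_finsetSum _ fun a _ => ?_).neg
  have h1 : Continuous fun w : Ω → ℝ => IT.dist w X a := by
    unfold IT.dist
    refine continuous_finsetSum _ fun ω _ => ?_
    split_ifs
    · exact continuous_apply ω
    · exact continuous_const
  have h2 : Continuous fun x : ℝ => x * Real.logb 2 x := by
    have : (fun x : ℝ => x * Real.logb 2 x) = fun x => x * Real.log x / Real.log 2 := by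
      funext x
      unfold Real.logb
      ring
    rw [this]
    exact Real.continuous_mul_log.div_const _
  exact h2.comp h1

theorem continuous_condMutInfo : Continuous (fun q : A × B × C → ℝ =>
    IT.condMutInfo q (fun v => v.2.1) (fun v => v.2.2) (fun v => v.1)) := by
  unfold IT.condMutInfo IT.condH
  exact ((continuous_H _).sub (continuous_H _)).sub ((continuous_H _).sub (continuous_H _))

theorem compact_limit (p : A × B → ℝ) (φ : A × B × C → ℝ) (D I S : ℝ) (δ : ℕ → ℝ)
    (hδ : Filter.Tendsto δ Filter.atTop (nhds 0))
    (h : ∀ k, ∃ q : A × B × C → ℝ, (∀ v, 0 ≤ q v) ∧ (∀ a b, (∑ c, q (a, b, c)) = p (a, b)) ∧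
      IT.expect q φ ≤ D + δ k ∧ info q p ≤ I + δ k ∧ hX1 p + info q p ≤ S + δ k) :
    ∃ q : A × B × C → ℝ, (∀ v, 0 ≤ q v) ∧ (∀ a b, (∑ c, q (a, b, c)) = p (a, b)) ∧
      IT.expect q φ ≤ D ∧ info q p ≤ I ∧ hX1 p + info q p ≤ S := by
  choose q hq hm h1 h2 h3 using h
  have hK : IsCompact (Set.Icc (0 : A × B × C → ℝ) (fun v => p (v.1, v.2.1))) := isCompact_Icc
  obtain ⟨q0, hq0, θ, hθ, hlim⟩ := hK.tendsto_subseq (x := q) (fun k =>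
    ⟨fun v => hq k v, fun v => le_marg (q k) (hq k) p (hm k) v⟩)
  have hq0' : ∀ v, 0 ≤ q0 v := fun v => hq0.1 v
  have hmc : ∀ a b, (∑ c, q0 (a, b, c)) = p (a, b) := by
    intro a b
    have hc : Continuous fun q : A × B × C → ℝ => ∑ c, q (a, b, c) :=
      continuous_finsetSum _ fun c _ => continuous_apply _
    have := (hc.tendsto q0).comp hlim
    refine tendsto_nhds_unique this ?_
    simp only [Function.comp_def, hm]
    exact tendsto_const_nhds
  have hδ' : Filter.Tendsto (δ ∘ θ) Filter.atTop (nhds 0) := hδ.comp hθ.tendsto_atTop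
  have hI : Filter.Tendsto (fun k => info (q (θ k)) p) Filter.atTop (nhds (info q0 p)) := by
    have := (continuous_condMutInfo.tendsto q0).comp hlim
    rw [condMutInfo_eq q0 hq0' p hmc] at this
    refine this.congr fun k => ?_
    exact condMutInfo_eq _ (hq _) p (hm _)
  refine ⟨q0, hq0', hmc, ?_, ?_, ?_⟩
  · have hc : Continuous fun q : A × B × C → ℝ => IT.expect q φ :=
      continuous_finsetSum _ fun v _ => (continuous_apply v).mul continuous_const
    have t1 := (hc.tendsto q0).comp hlim
    have t2 := hδ'.const_add D
    rw [add_zero] at t2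
    exact le_of_tendsto_of_tendsto' t1 t2 fun k => h1 _
  · have t2 := hδ'.const_add I
    rw [add_zero] at t2
    exact le_of_tendsto_of_tendsto' hI t2 fun k => h2 _
  · have t2 := hδ'.const_add S
    rw [add_zero] at t2
    exact le_of_tendsto_of_tendsto' (hI.const_add _) t2 fun k => h3 _

/-- residual of the Fano-type bound -/
def fano (A : Type*) [Fintype A] (ε : ℝ) : ℝ :=
  -(Real.logb 2 (1 - ε)) - ε * Real.logb 2 ε + ε * Real.logb 2 (Fintype.card A)

theorem fano_tendsto (A : Type*) [Fintype A] :
    Filter.Tendsto (fun k : ℕ => 2 * (1 / ((k : ℝ) + 2)) + fano A (1 / ((k : ℝ) + 2)))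
      Filter.atTop (nhds 0) := by
  have h0 : Filter.Tendsto (fun k : ℕ => 1 / ((k : ℝ) + 2)) Filter.atTop (nhds 0) := by
    have := (tendsto_const_div_atTop_nhds_zero_nat (1 : ℝ)).comp (Filter.tendsto_add_atTop_nat 2)
    refine this.congr fun k => ?_
    simp
  have hc : ContinuousAt (fun ε : ℝ => 2 * ε + fano A ε) 0 := by
    unfold fano
    have h1 : ContinuousAt (fun ε : ℝ => Real.logb 2 (1 - ε)) 0 := by
      unfold Real.logb
      exact (ContinuousAt.log (by fun_prop) (by norm_num)).div_const _
    have h2 : ContinuousAt (fun ε : ℝ => ε * Real.logb 2 ε) 0 := by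
      have : (fun x : ℝ => x * Real.logb 2 x) = fun x => x * Real.log x / Real.log 2 := by
        funext x
        unfold Real.logb
        ring
      rw [this]
      exact (Real.continuous_mul_log.div_const _).continuousAt
    exact (by fun_prop : ContinuousAt (fun ε : ℝ => 2 * ε) 0).add
      ((h1.neg.sub h2).add (by fun_prop))
  have := hc.tendsto.comp h0
  have h00 : 2 * (0 : ℝ) + fano A 0 = 0 := by simp [fano]
  rw [h00] at this
  exact this

end Support


/-! ### The converse theorem -/

theorem converse_main
    {X1 X2 Xh2 : Type} [Fintype X1] [Fintype X2] [Fintype Xh2]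
    [Nonempty X1] [Nonempty X2] [Nonempty Xh2]
    (p : X1 × X2 → ℝ) (hp : IsPMF p)
    (d2 : X2 → Xh2 → ℝ) (hd2 : ∀ x y, 0 ≤ d2 x y)
    (R1 R2 D32 : ℝ)
    (hyp :
    (∀ ε > (0 : ℝ), ∃ (n K : ℕ), 0 < n ∧ ∃ m1 m2 : Fin K → ℕ,
      (∀ l, 0 < m1 l) ∧ (∀ l, 0 < m2 l) ∧
      ∃ (J1 : (l : Fin K) → (Fin n → X1 × X2) → Fin (m1 l))
        (J2 : (l : Fin K) → (Fin n → X1 × X2) → Fin (m2 l))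
        (g31 : ((l : Fin K) → Fin (m1 l)) → ((l : Fin K) → Fin (m2 l)) → Fin n → X1)
        (g32 : ((l : Fin K) → Fin (m1 l)) → ((l : Fin K) → Fin (m2 l)) → Fin n → Xh2),
        -- node 1's message at round `l` is a function of `X₁ⁿ` and node 2's past messages
        (∀ l : Fin K, ∃ f : (Fin n → X1) →
            ((k : Fin K) → k.val < l.val → Fin (m2 k)) → Fin (m1 l),
          ∀ ω, J1 l ω = f (fun t => (ω t).1) (fun k _ => J2 k ω)) ∧
        -- node 2's message at round `l` is a function of `X₂ⁿ` and node 1's messages up to `l`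
        (∀ l : Fin K, ∃ f : (Fin n → X2) →
            ((k : Fin K) → k.val ≤ l.val → Fin (m1 k)) → Fin (m2 l),
          ∀ ω, J2 l ω = f (fun t => (ω t).2) (fun k _ => J1 k ω)) ∧
        -- rates
        (1 / (n : ℝ)) * ∑ l, Real.logb 2 (m1 l) ≤ R1 + ε ∧
        (1 / (n : ℝ)) * ∑ l, Real.logb 2 (m2 l) ≤ R2 + ε ∧
        -- lossless reconstruction of `X₁ⁿ` at node 3
        IT.pr (iidW p n)
          (fun ω => (fun t => g31 (fun l => J1 l ω) (fun l => J2 l ω) t) ≠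
            fun t => (ω t).1) ≤ ε ∧
        -- distortion constraint on the reconstruction of `X₂ⁿ` at node 3
        (1 / (n : ℝ)) * ∑ t : Fin n, IT.expect (iidW p n)
            (fun ω => d2 (ω t).2 (g32 (fun l => J1 l ω) (fun l => J2 l ω) t)) ≤ D32 + ε)) :
    (∃ u : ℕ, u ≤ Fintype.card X1 * Fintype.card X2 + 1 ∧
      ∃ q : X1 × X2 × Fin u → ℝ, IsPMF q ∧
        (∀ a b, (∑ c, q (a, b, c)) = p (a, b)) ∧
        ∃ g : X1 → Fin u → Xh2,
          IT.expect q (fun v => d2 v.2.1 (g v.1 v.2.2)) ≤ D32 ∧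
          IT.condH q (fun v => v.1) (fun v => v.2.1) ≤ R1 ∧
          IT.condMutInfo q (fun v => v.2.1) (fun v => v.2.2) (fun v => v.1) ≤ R2 ∧
          IT.H q (fun v => v.1) +
            IT.condMutInfo q (fun v => v.2.1) (fun v => v.2.2) (fun v => v.1) ≤ R1 + R2) := by
  classical
  have hst : ∀ k : ℕ, ∃ q : X1 × X2 × Xh2 → ℝ, (∀ v, 0 ≤ q v) ∧
      (∀ a b, (∑ c, q (a, b, c)) = p (a, b)) ∧
      IT.expect q (fun v => d2 v.2.1 v.2.2) ≤
        D32 + (2 * (1 / ((k : ℝ) + 2)) + fano X1 (1 / ((k : ℝ) + 2))) ∧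
      info q p ≤ R2 + (2 * (1 / ((k : ℝ) + 2)) + fano X1 (1 / ((k : ℝ) + 2))) ∧
      hX1 p + info q p ≤ R1 + R2 + (2 * (1 / ((k : ℝ) + 2)) + fano X1 (1 / ((k : ℝ) + 2))) ∧
      hX1X2 p ≤ R1 + (2 * (1 / ((k : ℝ) + 2)) + fano X1 (1 / ((k : ℝ) + 2))) := by
    intro k
    set ε : ℝ := 1 / ((k : ℝ) + 2) with hε
    have hk : (0 : ℝ) ≤ k := Nat.cast_nonneg k
    have h0 : 0 < ε := by positivity
    have h1 : ε < 1 := by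
      rw [hε, div_lt_one (by positivity)]; linarith
    obtain ⟨n, K, hn, m1, m2, hm1, hm2, J1, J2, g31, g32, hJ1, hJ2, hR1, hR2, he, hD⟩ := hyp ε h0
    choose f1 hf1 using hJ1
    choose f2 hf2 using hJ2
    have hn' : (1 : ℝ) ≤ n := by exact_mod_cast hn
    have hn0 : (0 : ℝ) < n := by linarith
    have hc1 : Real.logb 2 (Fintype.card ((l : Fin K) → Fin (m1 l))) = ∑ l, Real.logb 2 (m1 l) := by
      rw [Fintype.card_pi]
      push_cast
      rw [Real.logb_prod]
      · simp
      · intro l _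
        simpa using (hm1 l).ne'
    have hc2 : Real.logb 2 (Fintype.card ((l : Fin K) → Fin (m2 l))) = ∑ l, Real.logb 2 (m2 l) := by
      rw [Fintype.card_pi]
      push_cast
      rw [Real.logb_prod]
      · simp
      · intro l _
        simpa using (hm2 l).ne'
    have ha := conv_a p n (fun ω l => J1 l ω) (fun ω l => J2 l ω)
      (fun x2 j l => f2 l x2 (fun k _ => j k)) g31 hp hn ε h0 h1
      (fun ω => funext fun l => hf2 l ω) he
    have hb := conv_b p n (fun ω l => J1 l ω) (fun ω l => J2 l ω) g31 g32 hp hn ε h0 h1 he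
    have hc := conv_c p n (fun ω l => J1 l ω) (fun ω l => J2 l ω)
      (fun x1 j l => f1 l x1 (fun k _ => j k)) g32 hp hn
      (fun ω => funext fun l => hf1 l ω)
    rw [hc1] at ha hb
    rw [hc2] at hb hc
    rw [one_div, inv_mul_le_iff₀ hn0] at hR1 hR2
    set q := qbar p n fun ω => g32 (fun l => J1 l ω) (fun l => J2 l ω) with hq
    have hl1 : Real.logb 2 (1 - ε) ≤ 0 :=
      Real.logb_nonpos (by norm_num) (by linarith) (by linarith)
    have hl2 : ε * Real.logb 2 ε ≤ 0 :=
      mul_nonpos_of_nonneg_of_nonpos h0.le (Real.logb_nonpos (by norm_num) h0.le h1.le)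
    have hl3 : 0 ≤ ε * Real.logb 2 (Fintype.card X1) := by
      refine mul_nonneg h0.le (Real.logb_nonneg (by norm_num) ?_)
      exact_mod_cast Fintype.card_pos
    have hfano : -(Real.logb 2 (1 - ε) + ε * Real.logb 2 ε
        - ε * (n * Real.logb 2 (Fintype.card X1))) ≤ n * fano X1 ε := by
      unfold fano
      nlinarith
    have hfano0 : 0 ≤ fano X1 ε := by unfold fano; linarith
    refine ⟨q, qbar_nonneg p hp n _, qbar_marg p hp n hn _, ?_, ?_, ?_, ?_⟩
    · have : IT.expect q (fun v => d2 v.2.1 v.2.2) ≤ D32 + ε := by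
        refine le_trans (le_of_eq ?_) hD
        unfold IT.expect
        rw [hq, sum_qbar]
      linarith
    · refine le_of_mul_le_mul_left (le_trans (hc.trans hR2) ?_) hn0
      refine mul_le_mul_of_nonneg_left ?_ hn0.le
      linarith
    · refine le_of_mul_le_mul_left (hb.trans ?_) hn0
      linarith
    · refine le_of_mul_le_mul_left (ha.trans ?_) hn0
      nlinarith
  have hlim := fano_tendsto X1
  have hA : hX1X2 p ≤ R1 := by
    have t2 := hlim.const_add R1
    rw [add_zero] at t2
    refine ge_of_tendsto' t2 fun k => ?_
    obtain ⟨q, _, _, _, _, _, h⟩ := hst k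
    exact h
  obtain ⟨q, hq, hm, h1, h2, h3⟩ := compact_limit p (fun v => d2 v.2.1 v.2.2) D32 R2 (R1 + R2) _ hlim
    (fun k => by
      obtain ⟨q, a1, a2, a3, a4, a5, _⟩ := hst k
      exact ⟨q, a1, a2, a3, a4, a5⟩)
  -- transfer to `Fin u`
  let e := Fintype.equivFin Xh2
  have hm' : ∀ a b, (∑ c, (fun v : X1 × X2 × Fin (Fintype.card Xh2) =>
      q (v.1, v.2.1, e.symm v.2.2)) (a, b, c)) = p (a, b) := by
    intro a b
    rw [← hm]
    exact Equiv.sum_comp e.symm (fun c => q (a, b, c))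
  obtain ⟨u, hu, q', hq', hm'', g, e1, e2⟩ := reduce_support d2 p (Fintype.card Xh2)
    (fun v => q (v.1, v.2.1, e.symm v.2.2)) (fun v => hq _) hm' (fun _ c => e.symm c)
  have e1' : IT.expect (fun v : X1 × X2 × Fin (Fintype.card Xh2) => q (v.1, v.2.1, e.symm v.2.2))
      (fun v => d2 v.2.1 (e.symm v.2.2)) = IT.expect q (fun v => d2 v.2.1 v.2.2) := by
    rw [expect_slices, expect_slices]
    exact Equiv.sum_comp e.symm (fun c => ∑ x : X1 × X2, q (x.1, x.2, c) * d2 x.2 c)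
  have e2' : info (fun v : X1 × X2 × Fin (Fintype.card Xh2) => q (v.1, v.2.1, e.symm v.2.2)) p
      = info q p := by
    rw [info_slices _ p hm', info_slices _ p hm]
    congr 1
    exact Equiv.sum_comp e.symm (fun c => ∑ x : X1 × X2, q (x.1, x.2, c) *
      Real.logb 2 (kch q (x.1, x.2, c)))
  rw [e1'] at e1
  rw [e2'] at e2
  refine ⟨u, hu, q', ⟨hq', ?_⟩, hm'', g, e1.trans h1, ?_, ?_, ?_⟩
  · have := sum_marg q' p hm'' (fun _ => 1)
    simpa [hp.2] using this
  · rw [condH_eq q' hq' p hm'']; exact hA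
  · rw [condMutInfo_eq q' hq' p hm'']; linarith
  · rw [condMutInfo_eq q' hq' p hm'', H_eq q' p hm'']; linarith


/-! ### Tools for achievability -/

section Tools

variable {Ω : Type*} [Fintype Ω]

theorem pr_mono (w : Ω → ℝ) (hw : ∀ ω, 0 ≤ w ω) (E F : Ω → Prop)
    (h : ∀ ω, 0 < w ω → E ω → F ω) : IT.pr w E ≤ IT.pr w F := by
  classical
  unfold IT.pr
  refine Finset.sum_le_sum fun ω _ => ?_
  rcases (hw ω).eq_or_lt with h0 | h0
  · simp [← h0]
  · by_cases hE : E ω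
    · simp [hE, h ω h0 hE]
    · rw [if_neg hE]
      split_ifs
      · exact h0.le
      · exact le_rfl

theorem pr_or (w : Ω → ℝ) (hw : ∀ ω, 0 ≤ w ω) (E F : Ω → Prop) :
    IT.pr w (fun ω => E ω ∨ F ω) ≤ IT.pr w E + IT.pr w F := by
  classical
  unfold IT.pr
  rw [← Finset.sum_add_distrib]
  refine Finset.sum_le_sum fun ω _ => ?_
  have := hw ω
  by_cases hE : E ω <;> by_cases hF : F ω <;> simp [hE, hF, this]

theorem pr_nonneg (w : Ω → ℝ) (hw : ∀ ω, 0 ≤ w ω) (E : Ω → Prop) : 0 ≤ IT.pr w E := by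
  classical
  unfold IT.pr
  refine Finset.sum_nonneg fun ω _ => ?_
  split_ifs
  · exact hw ω
  · exact le_rfl

open Classical in
theorem pr_eq (w : Ω → ℝ) (E : Ω → Prop) : IT.pr w E = ∑ ω, w ω * (if E ω then 1 else 0) := by
  unfold IT.pr
  refine Finset.sum_congr rfl fun ω _ => ?_
  split_ifs <;> simp

theorem exists_le_avg (w f : Ω → ℝ) (hw : ∀ ω, 0 ≤ w ω) (h1 : ∑ ω, w ω = 1) (E : ℝ)
    (h : ∑ ω, w ω * f ω ≤ E) : ∃ ω, f ω ≤ E := by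
  by_contra hcon
  push Not at hcon
  have h2 : ∀ ω ∈ Finset.univ, 0 ≤ w ω * (f ω - E) := fun ω _ =>
    mul_nonneg (hw ω) (by linarith [hcon ω])
  have h3 : ∑ ω, w ω * (f ω - E) ≤ 0 := by
    simp_rw [mul_sub]
    rw [Finset.sum_sub_distrib, ← Finset.sum_mul, h1]
    linarith
  have h4 := (Finset.sum_eq_zero_iff_of_nonneg h2).mp (le_antisymm h3 (Finset.sum_nonneg h2))
  have h5 : ∑ ω, w ω = 0 := Finset.sum_eq_zero fun ω hω => by
    rcases mul_eq_zero.mp (h4 ω hω) with h | h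
    · exact h
    · linarith [hcon ω]
  linarith

theorem second_moment {V : Type*} [Fintype V] (p : V → ℝ) (hp : IsPMF p) (h : V → ℝ)
    (h0 : ∑ v, p v * h v = 0) (n : ℕ) :
    ∑ ω, iidW p n ω * (∑ t, h (ω t)) ^ 2 = n * ∑ v, p v * h v ^ 2 := by
  classical
  have : ∀ ω : Fin n → V, iidW p n ω * (∑ t, h (ω t)) ^ 2 =
      ∑ s, ∑ t, iidW p n ω * (h (ω s) * h (ω t)) := by
    intro ω
    rw [sq, Finset.sum_mul_sum, Finset.mul_sum]
    simp_rw [Finset.mul_sum]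
  simp_rw [this]
  rw [Finset.sum_comm]
  have h2 : ∀ s : Fin n, ∑ ω, ∑ t, iidW p n ω * (h (ω s) * h (ω t)) = ∑ v, p v * h v ^ 2 := by
    intro s
    rw [Finset.sum_comm, Finset.sum_eq_single s]
    · have := marg_prodW p hp.2 s (fun v => h v ^ 2)
      simpa [iidW, sq] using this
    · intro t _ hts
      have := pair_prodW p hp.2 s t hts.symm h h
      rw [h0, zero_mul] at this
      exact this
    · simp
  simp [h2]

theorem wlln {V : Type*} [Fintype V] (p : V → ℝ) (hp : IsPMF p) (f : V → ℝ) (δ η : ℝ)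
    (hδ : 0 < δ) (hη : 0 < η) : ∃ N : ℕ, ∀ n ≥ N,
      IT.pr (iidW p n) (fun ω => n * (∑ v, p v * f v + δ) < ∑ t, f (ω t)) ≤ η := by
  classical
  set μ := ∑ v, p v * f v with hμ
  set σ := ∑ v, p v * (f v - μ) ^ 2 with hσ
  have hσ0 : 0 ≤ σ := Finset.sum_nonneg fun v _ => mul_nonneg (hp.1 v) (sq_nonneg _)
  have hm : ∑ v, p v * (f v - μ) = 0 := by
    simp_rw [mul_sub]
    rw [Finset.sum_sub_distrib, ← Finset.sum_mul, hp.2]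
    linarith
  refine ⟨⌈σ / (δ ^ 2 * η)⌉₊ + 1, fun n hn => ?_⟩
  have hn1 : σ / (δ ^ 2 * η) ≤ n := by
    refine (Nat.le_ceil _).trans ?_
    exact_mod_cast (by omega : ⌈σ / (δ ^ 2 * η)⌉₊ ≤ n)
  have hn0 : (0 : ℝ) < n := by exact_mod_cast (by omega : 0 < n)
  have hsm := second_moment p hp (fun v => f v - μ) hm n
  have hle : (n * δ) ^ 2 * IT.pr (iidW p n) (fun ω => n * (μ + δ) < ∑ t, f (ω t)) ≤
      ∑ ω, iidW p n ω * (∑ t, (f (ω t) - μ)) ^ 2 := by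
    rw [pr_eq, Finset.mul_sum]
    refine Finset.sum_le_sum fun ω _ => ?_
    have hw := iidW_nonneg p hp.1 n ω
    split_ifs with hE
    · have : n * δ ≤ ∑ t, (f (ω t) - μ) := by
        rw [Finset.sum_sub_distrib]
        simp
        linarith
      have h2 : (n * δ) ^ 2 ≤ (∑ t, (f (ω t) - μ)) ^ 2 := pow_le_pow_left₀ (by positivity) this 2
      nlinarith
    · simp only [mul_zero]
      positivity
  rw [hsm] at hle
  rw [div_le_iff₀ (by positivity)] at hn1
  have h3 : (n * δ) ^ 2 * IT.pr (iidW p n) (fun ω => n * (μ + δ) < ∑ t, f (ω t)) ≤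
      (n * δ) ^ 2 * η := by
    refine hle.trans ?_
    have : n * σ ≤ n * (n * (δ ^ 2 * η)) := mul_le_mul_of_nonneg_left hn1 hn0.le
    calc _ ≤ n * (n * (δ ^ 2 * η)) := this
      _ = _ := by ring
  exact le_of_mul_le_mul_left h3 (by positivity)

theorem list_card {A : Type*} [Fintype A] (P : A → ℝ) (hP : ∀ a, 0 ≤ P a) (L : ℝ) (hL : 0 ≤ L)
    (S : Finset A) (hS : ∀ a ∈ S, 0 < P a ∧ (∑ a, P a) ≤ L * P a) : (S.card : ℝ) ≤ L := by
  rcases S.eq_empty_or_nonempty with h | ⟨a, ha⟩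
  · simp [h, hL]
  · have hT : 0 < ∑ a, P a := (hS a ha).1.trans_le
      (Finset.single_le_sum (fun a _ => hP a) (Finset.mem_univ a))
    have h1 : (S.card : ℝ) * (∑ a, P a) ≤ ∑ a ∈ S, L * P a := by
      rw [← nsmul_eq_mul]
      exact Finset.card_nsmul_le_sum S _ _ fun a ha => (hS a ha).2
    have h2 : ∑ a ∈ S, P a ≤ ∑ a, P a :=
      Finset.sum_le_sum_of_subset_of_nonneg (Finset.subset_univ _) fun a _ _ => hP a
    rw [← Finset.mul_sum] at h1
    have h3 := h1.trans (mul_le_mul_of_nonneg_left h2 hL)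
    exact le_of_mul_le_mul_right h3 hT

open Classical in
theorem binning {A B Θ G : Type*} [Fintype A] [Fintype Θ] (w : Ω → ℝ)
    (hw : ∀ ω, 0 ≤ w ω) (hw1 : ∑ ω, w ω = 1) (X : Ω → A) (Y : Ω → B) (μ : Θ → ℝ)
    (hμ : ∀ θ, 0 ≤ μ θ) (hμ1 : ∑ θ, μ θ = 1) (h : Θ → A → G) (κ L : ℝ) (hκ0 : 0 ≤ κ)
    (hκ : ∀ a a', a ≠ a' → IT.pr μ (fun θ => h θ a = h θ a') ≤ κ) (S : A → B → Prop)
    (hS : ∀ b, ((Finset.univ.filter (fun a => S a b)).card : ℝ) ≤ L) :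
    ∑ θ, μ θ * IT.pr w (fun ω => ¬ S (X ω) (Y ω) ∨
      ∃ a', a' ≠ X ω ∧ S a' (Y ω) ∧ h θ a' = h θ (X ω)) ≤
    IT.pr w (fun ω => ¬ S (X ω) (Y ω)) + L * κ := by
  have step : ∀ θ, IT.pr w (fun ω => ¬ S (X ω) (Y ω) ∨
      ∃ a', a' ≠ X ω ∧ S a' (Y ω) ∧ h θ a' = h θ (X ω)) ≤
      IT.pr w (fun ω => ¬ S (X ω) (Y ω)) + ∑ ω, w ω *
        ∑ a' ∈ Finset.univ.filter (fun a => S a (Y ω)),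
          (if a' ≠ X ω ∧ h θ a' = h θ (X ω) then 1 else 0) := by
    intro θ
    refine (pr_or w hw _ _).trans (add_le_add_right ?_ _)
    rw [pr_eq]
    refine Finset.sum_le_sum fun ω _ => mul_le_mul_of_nonneg_left ?_ (hw ω)
    have hnn : ∀ a' ∈ Finset.univ.filter (fun a => S a (Y ω)),
        (0 : ℝ) ≤ (if a' ≠ X ω ∧ h θ a' = h θ (X ω) then 1 else 0) := by
      intro a' _
      split_ifs <;> norm_num
    split_ifs with hE
    · obtain ⟨a', h1, h2, h3⟩ := hE
      refine le_trans ?_ (Finset.single_le_sum hnn (a := a') (by simp [h2]))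
      rw [if_pos ⟨h1, h3⟩]
    · exact Finset.sum_nonneg hnn
  calc _ ≤ ∑ θ, μ θ * (IT.pr w (fun ω => ¬ S (X ω) (Y ω)) + ∑ ω, w ω *
        ∑ a' ∈ Finset.univ.filter (fun a => S a (Y ω)),
          (if a' ≠ X ω ∧ h θ a' = h θ (X ω) then 1 else 0)) :=
        Finset.sum_le_sum fun θ _ => mul_le_mul_of_nonneg_left (step θ) (hμ θ)
    _ = IT.pr w (fun ω => ¬ S (X ω) (Y ω)) + ∑ ω, w ω *
        ∑ a' ∈ Finset.univ.filter (fun a => S a (Y ω)),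
          ∑ θ, μ θ * (if a' ≠ X ω ∧ h θ a' = h θ (X ω) then 1 else 0) := by
        simp_rw [mul_add]
        rw [Finset.sum_add_distrib, ← Finset.sum_mul, hμ1, one_mul]
        congr 1
        simp_rw [Finset.mul_sum]
        rw [Finset.sum_comm]
        refine Finset.sum_congr rfl fun ω _ => ?_
        rw [Finset.sum_comm]
        refine Finset.sum_congr rfl fun a _ => Finset.sum_congr rfl fun θ _ => ?_
        ring
    _ ≤ IT.pr w (fun ω => ¬ S (X ω) (Y ω)) + ∑ ω, w ω * (L * κ) := by
        refine add_le_add_right ?_ _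
        refine Finset.sum_le_sum fun ω _ => mul_le_mul_of_nonneg_left ?_ (hw ω)
        calc _ ≤ ∑ a' ∈ Finset.univ.filter (fun a => S a (Y ω)), κ := by
              refine Finset.sum_le_sum fun a' _ => ?_
              by_cases hne : a' = X ω
              · simp [hne, hκ0]
              · refine le_trans (le_of_eq ?_) (hκ a' (X ω) hne)
                rw [pr_eq]
                simp [hne]
          _ ≤ L * κ := by
              rw [Finset.sum_const, nsmul_eq_mul]
              exact mul_le_mul_of_nonneg_right (hS _) hκ0
    _ = _ := by rw [← Finset.sum_mul, hw1, one_mul]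

theorem hash_collision {A V G : Type*} [Fintype A] [DecidableEq A] [Fintype V] [Fintype G]
    (w : V → ℝ) (hw : ∀ v, 0 ≤ w v) (hw1 : ∑ v, w v = 1) (π : V → G) (κ : ℝ)
    (hκ : ∀ y, IT.dist w π y ≤ κ) (a a' : A) (hne : a ≠ a') :
    IT.pr (fun θ : A → V => ∏ r, w (θ r)) (fun θ => π (θ a) = π (θ a')) ≤ κ := by
  classical
  rw [pr_eq]
  have h1 : ∀ θ : A → V, (∏ r, w (θ r)) * (if π (θ a) = π (θ a') then (1 : ℝ) else 0) =
      ∑ y, (∏ r, w (θ r)) * ((if π (θ a) = y then (1 : ℝ) else 0) * (if π (θ a') = y then 1 else 0)) := by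
    intro θ
    rw [← Finset.mul_sum]
    congr 1
    simp [eq_comm]
  have h2 : ∀ y, ∑ v, w v * (if π v = y then (1 : ℝ) else 0) = IT.dist w π y := by
    intro y
    unfold IT.dist
    refine Finset.sum_congr rfl fun v _ => ?_
    split_ifs <;> simp
  calc _ = ∑ y, IT.dist w π y * IT.dist w π y := by
        rw [Finset.sum_congr rfl (fun θ _ => h1 θ), Finset.sum_comm]
        refine Finset.sum_congr rfl fun y _ => ?_
        rw [pair_prodW w hw1 a a' hne (fun v => if π v = y then 1 else 0)
          (fun v => if π v = y then 1 else 0), h2]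
    _ ≤ ∑ y, IT.dist w π y * κ :=
        Finset.sum_le_sum fun y _ => mul_le_mul_of_nonneg_left (hκ y) (dist_nonneg' w hw π y)
    _ = κ := by
        rw [sum_dist w π (fun _ => κ), ← Finset.sum_mul, hw1, one_mul]

theorem exp_cvx (x α : ℝ) (h0 : 0 ≤ α) (h1 : α ≤ 1) :
    Real.exp (-(α * x)) ≤ 1 - α + Real.exp (-x) := by
  have h := convexOn_exp.2 (Set.mem_univ (0 : ℝ)) (Set.mem_univ (-x))
    (by linarith : 0 ≤ 1 - α) h0 (by ring)
  simp only [smul_eq_mul, mul_zero, zero_add, Real.exp_zero, mul_one, mul_neg] at h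
  have := Real.exp_pos (-x)
  nlinarith

open Classical in
theorem covering {B V : Type*} [Fintype B] [Fintype V] [Nonempty V] (Q : B → V → ℝ)
    (hQ : ∀ b v, 0 ≤ Q b v) (T : ℝ) (hT : 0 < T) (G : B → V → Prop)
    (hG : ∀ b v, G b v → Q b v * (∑ b, ∑ v, Q b v) ≤ T * ((∑ b, Q b v) * ∑ v, Q b v)) (M : ℕ) :
    ∃ c : Fin M → V, ∑ b, (if ∀ m, ¬ G b (c m) then ∑ v, Q b v else 0) ≤
      ∑ b, ∑ v, (if ¬ G b v then Q b v else 0) + (∑ b, ∑ v, Q b v) * Real.exp (-(M / T)) := by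
  set T1 := ∑ b, ∑ v, Q b v with hT1
  have hP : ∀ b, 0 ≤ ∑ v, Q b v := fun b => Finset.sum_nonneg fun v _ => hQ b v
  have hR : ∀ v, 0 ≤ ∑ b, Q b v := fun v => Finset.sum_nonneg fun b _ => hQ b v
  have hT10 : 0 ≤ T1 := Finset.sum_nonneg fun b _ => hP b
  rcases hT10.eq_or_lt with h0 | h0
  · refine ⟨fun _ => Classical.arbitrary V, ?_⟩
    have hz : ∀ b, ∑ v, Q b v = 0 := fun b =>
      (Finset.sum_eq_zero_iff_of_nonneg fun b _ => hP b).mp h0.symm b (Finset.mem_univ b)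
    rw [← h0, zero_mul, add_zero]
    simp only [hz, ite_self, Finset.sum_const_zero]
    refine Finset.sum_nonneg fun b _ => Finset.sum_nonneg fun v _ => ?_
    split_ifs <;> first | exact hQ b v | exact le_rfl
  · set r : V → ℝ := fun v => (∑ b, Q b v) / T1 with hr
    have hr0 : ∀ v, 0 ≤ r v := fun v => div_nonneg (hR v) h0.le
    have hr1 : ∑ v, r v = 1 := by
      rw [hr, ← Finset.sum_div, Finset.sum_comm, div_self h0.ne']
    refine exists_le_avg (fun c : Fin M → V => ∏ m, r (c m)) _
      (fun c => Finset.prod_nonneg fun _ _ => hr0 _) (sum_prodW r hr1) _ ?_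
    have hterm : ∀ (c : Fin M → V) (b : B), (∏ m, r (c m)) *
        (if ∀ m, ¬ G b (c m) then ∑ v, Q b v else 0) =
        (∑ v, Q b v) * ∏ m, (r (c m) * (if ¬ G b (c m) then 1 else 0)) := by
      intro c b
      rw [Finset.prod_mul_distrib]
      by_cases hc : ∀ m, ¬ G b (c m)
      · simp [hc, mul_comm]
      · rw [if_neg hc]
        push Not at hc
        obtain ⟨m, hm⟩ := hc
        have : ∏ m, (if ¬ G b (c m) then (1 : ℝ) else 0) = 0 :=
          Finset.prod_eq_zero (Finset.mem_univ m) (by simp [hm])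
        rw [this]; simp
    have hmain : ∀ b, (∑ v, Q b v) * (∑ v, r v * (if ¬ G b v then 1 else 0)) ^ M ≤
        ∑ v, (if ¬ G b v then Q b v else 0) + (∑ v, Q b v) * Real.exp (-(M / T)) := by
      intro b
      have hnG : 0 ≤ ∑ v, (if ¬ G b v then Q b v else 0) := by
        refine Finset.sum_nonneg fun v _ => ?_
        split_ifs <;> first | exact hQ b v | exact le_rfl
      rcases (hP b).eq_or_lt with hb | hb
      · rw [← hb, zero_mul, zero_mul, add_zero]; exact hnG
      · set P := ∑ v, Q b v with hPdef
        set N := ∑ v, (if ¬ G b v then Q b v else 0) with hN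
        set Gs := ∑ v, (if G b v then Q b v else 0) with hGs
        have hsplit : Gs + N = P := by
          rw [hGs, hN, hPdef, ← Finset.sum_add_distrib]
          refine Finset.sum_congr rfl fun v _ => ?_
          by_cases h : G b v <;> simp [h]
        have hGs0 : 0 ≤ Gs := by
          refine Finset.sum_nonneg fun v _ => ?_
          split_ifs <;> first | exact hQ b v | exact le_rfl
        set β := ∑ v, r v * (if ¬ G b v then (1 : ℝ) else 0) with hβ
        have hβ0 : 0 ≤ β := Finset.sum_nonneg fun v _ => mul_nonneg (hr0 v) (by split_ifs <;> norm_num)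
        have hβ1 : β = 1 - ∑ v, (if G b v then r v else 0) := by
          rw [← hr1, hβ, ← Finset.sum_sub_distrib]
          refine Finset.sum_congr rfl fun v _ => ?_
          by_cases h : G b v <;> simp [h]
        have hlow : Gs / P / T ≤ ∑ v, (if G b v then r v else 0) := by
          rw [hGs, Finset.sum_div, Finset.sum_div]
          refine Finset.sum_le_sum fun v _ => ?_
          split_ifs with h
          · rw [div_div, div_le_iff₀ (by positivity), hr]
            have := hG b v h
            simp only
            rw [div_mul_eq_mul_div, le_div_iff₀ h0]
            linarith
          · simp
        have hα1 : Gs / P ≤ 1 := by rw [div_le_one hb]; linarith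
        have hα0 : 0 ≤ Gs / P := by positivity
        have hβe : β ≤ Real.exp (-(Gs / P / T)) := by
          have := Real.add_one_le_exp (-(Gs / P / T))
          linarith
        have hpow : β ^ M ≤ 1 - Gs / P + Real.exp (-(M / T)) := by
          refine (pow_le_pow_left₀ hβ0 hβe M).trans ?_
          rw [← Real.exp_nat_mul]
          have := exp_cvx (M / T) (Gs / P) hα0 hα1
          refine le_trans (le_of_eq ?_) this
          congr 1
          ring
        have := mul_le_mul_of_nonneg_left hpow hb.le
        refine this.trans (le_of_eq ?_)
        rw [mul_add, mul_sub, mul_div_cancel₀ _ hb.ne']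
        linarith
    calc _ = ∑ b, (∑ v, Q b v) * (∑ v, r v * (if ¬ G b v then 1 else 0)) ^ M := by
          simp_rw [Finset.mul_sum]
          rw [Finset.sum_comm]
          refine Finset.sum_congr rfl fun b _ => ?_
          rw [Finset.sum_congr rfl (fun c _ => hterm c b), ← Finset.mul_sum,
            sum_prod_pi (fun (_ : Fin M) v => r v * (if ¬ G b v then 1 else 0))]
          simp
      _ ≤ _ := by
          refine (Finset.sum_le_sum fun b _ => hmain b).trans (le_of_eq ?_)
          rw [Finset.sum_add_distrib, ← Finset.sum_mul]

theorem exists_decoder {A B G : Type*} [Nonempty A] (S : A → B → Prop) (h : A → G) :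
    ∃ dec : G → B → A, ∀ a b, S a b → (∀ a', S a' b → h a' = h a → a' = a) → dec (h a) b = a := by
  classical
  refine ⟨fun g b => if hx : ∃ a, S a b ∧ h a = g then hx.choose else Classical.arbitrary A, ?_⟩
  intro a b hS hu
  have hx : ∃ a', S a' b ∧ h a' = h a := ⟨a, hS, rfl⟩
  simp only [dif_pos hx]
  exact hu _ hx.choose_spec.1 hx.choose_spec.2

end Tools

/-! ### One-shot achievability -/

theorem unif_dist_fst (M N : ℕ) (hN : 0 < N) (y : Fin M) :
    IT.dist (fun _ : Fin M × Fin N => 1 / ((M : ℝ) * N)) Prod.fst y = 1 / M := by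
  classical
  unfold IT.dist
  rw [Fintype.sum_prod_type, Finset.sum_eq_single y]
  · have : (N : ℝ) ≠ 0 := by positivity
    simp
    field_simp
  · intro b _ hb; simp [hb]
  · simp

theorem unif_dist_id (M N : ℕ) (y : Fin M × Fin N) :
    IT.dist (fun _ : Fin M × Fin N => 1 / ((M : ℝ) * N)) (fun x => x) y = 1 / ((M : ℝ) * N) := by
  classical
  unfold IT.dist
  simp

open Classical in
theorem oneshot {Ω A B V : Type*} [Fintype Ω] [Fintype A] [Fintype B] [Fintype V]
    [Nonempty A] [Nonempty V] (w : Ω → ℝ) (hw : ∀ ω, 0 ≤ w ω) (hw1 : ∑ ω, w ω = 1)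
    (X : Ω → A) (Y : Ω → B) (Q : A → B → V → ℝ) (hQ : ∀ a b v, 0 ≤ Q a b v)
    (hQw : ∀ F : A → B → ℝ, ∑ ω, w ω * F (X ω) (Y ω) = ∑ a, ∑ b, (∑ v, Q a b v) * F a b)
    (S1 : A → B → Prop) (S3 : A → Prop) (Gd : A → B → V → Prop) (L1 L3 T : ℝ) (hT : 0 < T)
    (hS1 : ∀ b, ((Finset.univ.filter (fun a => S1 a b)).card : ℝ) ≤ L1)
    (hS3 : ((Finset.univ.filter (fun a => S3 a)).card : ℝ) ≤ L3)
    (hG : ∀ a b v, Gd a b v →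
      Q a b v * (∑ b, ∑ v, Q a b v) ≤ T * ((∑ b, Q a b v) * ∑ v, Q a b v))
    (M1 N1 M2 : ℕ) (hM1 : 0 < M1) (hN1 : 0 < N1) (hM2 : 0 < M2) :
    ∃ (f1 : A → Fin M1) (F2 : B → Fin M1 → Fin N1 × Fin M2)
      (dA : Fin M1 → Fin N1 × Fin M2 → A) (dV : Fin M1 → Fin N1 × Fin M2 → V),
      IT.pr w (fun ω => ¬ (dA (f1 (X ω)) (F2 (Y ω) (f1 (X ω))) = X ω ∧
        Gd (X ω) (Y ω) (dV (f1 (X ω)) (F2 (Y ω) (f1 (X ω)))))) ≤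
      (IT.pr w (fun ω => ¬ S1 (X ω) (Y ω)) + L1 * (1 / M1)) +
      (IT.pr w (fun ω => ¬ S3 (X ω)) + L3 * (1 / ((M1 : ℝ) * N1))) +
      (∑ a, ∑ b, ∑ v, (if ¬ Gd a b v then Q a b v else 0) + Real.exp (-(M2 / T))) := by
  set w0 : Fin M1 × Fin N1 → ℝ := fun _ => 1 / ((M1 : ℝ) * N1) with hw0
  have hM1r : (0 : ℝ) < M1 := by exact_mod_cast hM1
  have hN1r : (0 : ℝ) < N1 := by exact_mod_cast hN1
  have hw00 : ∀ v, 0 ≤ w0 v := fun v => by rw [hw0]; positivity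
  have hw01 : ∑ v, w0 v = 1 := by
    simp [hw0]
    field_simp
  set μ : (A → Fin M1 × Fin N1) → ℝ := fun θ => ∏ r, w0 (θ r) with hμ
  have hμ0 : ∀ θ, 0 ≤ μ θ := fun θ => Finset.prod_nonneg fun r _ => hw00 (θ r)
  have hμ1 : ∑ θ, μ θ = 1 := sum_prodW w0 hw01
  have b1 := binning w hw hw1 X Y μ hμ0 hμ1 (fun θ a => (θ a).1) (1 / M1) L1 (by positivity)
    (fun a a' hne => hash_collision w0 hw00 hw01 Prod.fst (1 / M1)
      (fun y => (unif_dist_fst M1 N1 hN1 y).le) a a' hne) S1 hS1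
  have b3 := binning w hw hw1 X (fun _ => ()) μ hμ0 hμ1 (fun θ a => θ a) (1 / ((M1 : ℝ) * N1)) L3
    (by positivity)
    (fun a a' hne => hash_collision w0 hw00 hw01 (fun x => x) (1 / ((M1 : ℝ) * N1))
      (fun y => (unif_dist_id M1 N1 y).le) a a' hne) (fun a _ => S3 a) (fun _ => hS3)
  have b13 := add_le_add b1 b3
  rw [← Finset.sum_add_distrib] at b13
  simp_rw [← mul_add] at b13
  obtain ⟨θ, hθ⟩ := exists_le_avg μ _ hμ0 hμ1 _ b13
  choose c hc using fun a => covering (Q a) (hQ a) T hT (Gd a) (hG a) M2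
  obtain ⟨dec2, hdec2⟩ := exists_decoder S1 (fun a => (θ a).1)
  obtain ⟨dec3, hdec3⟩ := exists_decoder (fun a (_ : Unit) => S3 a) θ
  have : ∀ a b, ∃ m : Fin M2, (∃ m, Gd a b (c a m)) → Gd a b (c a m) := by
    intro a b
    by_cases h : ∃ m, Gd a b (c a m)
    · obtain ⟨m, hm⟩ := h
      exact ⟨m, fun _ => hm⟩
    · exact ⟨⟨0, hM2⟩, fun h' => absurd h' h⟩
  choose ix hix using this
  refine ⟨fun a => (θ a).1, fun b j => ((θ (dec2 j b)).2, ix (dec2 j b) b),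
    fun j k => dec3 (j, k.1) (), fun j k => c (dec3 (j, k.1) ()) k.2, ?_⟩
  have hcov : IT.pr w (fun ω => ∀ m, ¬ Gd (X ω) (Y ω) (c (X ω) m)) ≤
      ∑ a, ∑ b, ∑ v, (if ¬ Gd a b v then Q a b v else 0) + Real.exp (-(M2 / T)) := by
    have hpe := hQw (fun a b => if ∀ m, ¬ Gd a b (c a m) then 1 else 0)
    have hpe' : IT.pr w (fun ω => ∀ m, ¬ Gd (X ω) (Y ω) (c (X ω) m)) =
        ∑ ω, w ω * (if ∀ m, ¬ Gd (X ω) (Y ω) (c (X ω) m) then 1 else 0) := by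
      rw [pr_eq]
      refine Finset.sum_congr rfl fun ω _ => ?_
      congr
    rw [hpe', hpe]
    have h1 : ∑ a, ∑ b, ∑ v, Q a b v = 1 := by
      have := hQw (fun _ _ => 1)
      simp only [mul_one] at this
      rw [← this, hw1]
    calc _ = ∑ a, ∑ b, (if ∀ m, ¬ Gd a b (c a m) then ∑ v, Q a b v else 0) := by
          refine Finset.sum_congr rfl fun a _ => Finset.sum_congr rfl fun b _ => ?_
          split_ifs <;> simp
      _ ≤ ∑ a, (∑ b, ∑ v, (if ¬ Gd a b v then Q a b v else 0) +
            (∑ b, ∑ v, Q a b v) * Real.exp (-(M2 / T))) := Finset.sum_le_sum fun a _ => hc a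
      _ = _ := by rw [Finset.sum_add_distrib, ← Finset.sum_mul, h1, one_mul]
  refine le_trans ?_ (add_le_add hθ hcov)
  refine le_trans ?_ (add_le_add_left (pr_or w hw _ _) _)
  refine le_trans ?_ (pr_or w hw _ _)
  refine pr_mono w hw _ _ fun ω _ hE => ?_
  by_contra hcon
  push Not at hcon
  obtain ⟨⟨⟨h1, h2⟩, h3, h4⟩, h5⟩ := hcon
  apply hE
  have e2 : dec2 (θ (X ω)).1 (Y ω) = X ω :=
    hdec2 (X ω) (Y ω) h1 fun a' hs he => by
      by_contra hne
      exact h2 a' hne hs he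
  have e3 : dec3 (θ (X ω)) () = X ω :=
    hdec3 (X ω) () h3 fun a' hs he => by
      by_contra hne
      exact h4 a' hne hs he
  simp only [e2]
  have e4 : ((θ (X ω)).1, (θ (X ω)).2) = θ (X ω) := rfl
  rw [e4, e3]
  exact ⟨rfl, hix _ _ h5⟩

/-! ### n-letter achievability -/

theorem prod_typ {V : Type*} [Fintype V] (q : V → ℝ) (hq : IsPMF q) (α β : V → ℝ)
    (hα : ∀ v, 0 < q v → 0 < α v) (hβ : ∀ v, 0 < q v → 0 < β v) (μ : ℝ)
    (hμ : ∑ v, q v * Real.logb 2 (α v / β v) = μ) (δ η : ℝ) (hδ : 0 < δ) (hη : 0 < η) :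
    ∃ N : ℕ, ∀ n ≥ N, IT.pr (iidW q n) (fun ω => ¬ (0 < ∏ t, β (ω t) ∧
      ∏ t, α (ω t) ≤ (2 : ℝ) ^ (n * (μ + δ)) * ∏ t, β (ω t))) ≤ η := by
  obtain ⟨N, hN⟩ := wlln q hq (fun v => Real.logb 2 (α v / β v)) δ η hδ hη
  refine ⟨N, fun n hn => le_trans ?_ (hN n hn)⟩
  refine pr_mono _ (iidW_nonneg q hq.1 n) _ _ fun ω hω hE => ?_
  by_contra hcon
  push Not at hcon
  rw [hμ] at hcon
  apply hE
  have hpos : ∀ t, 0 < q (ω t) := by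
    intro t
    refine lt_of_le_of_ne (hq.1 _) fun h => ?_
    have : iidW q n ω = 0 := Finset.prod_eq_zero (Finset.mem_univ t) h.symm
    linarith
  have hb : 0 < ∏ t, β (ω t) := Finset.prod_pos fun t _ => hβ _ (hpos t)
  refine ⟨hb, ?_⟩
  rw [← div_le_iff₀ hb, ← Finset.prod_div_distrib]
  have h2 : ∏ t, α (ω t) / β (ω t) = (2 : ℝ) ^ (∑ t, Real.logb 2 (α (ω t) / β (ω t))) := by
    rw [Real.rpow_sum_of_pos (by norm_num)]
    refine Finset.prod_congr rfl fun t _ => ?_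
    rw [Real.rpow_logb (by norm_num) (by norm_num) (div_pos (hα _ (hpos t)) (hβ _ (hpos t)))]
  rw [h2]
  exact Real.rpow_le_rpow_of_exponent_le (by norm_num) hcon

theorem info_nonneg {A B C : Type*} [Fintype A] [Fintype B] [Fintype C] (q : A × B × C → ℝ)
    (hq : IsPMF q) (p : A × B → ℝ) (hp : IsPMF p) (h : ∀ a b, (∑ c, q (a, b, c)) = p (a, b)) :
    0 ≤ info q p := by
  have h1 : ∀ v, 0 < q v → 0 < p (v.1, v.2.1) := fun v hv => hv.trans_le (le_marg q hq.1 p h v)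
  have h2 : ∀ v, 0 < q v → 0 < mg13 q v.1 v.2.2 := fun v hv => hv.trans_le (le_mg13 q hq.1 v)
  have h3 : ∀ v, 0 < q v → 0 < mg1 p v.1 := fun v hv => (h1 v hv).trans_le (le_mg1 p hp.1 _)
  have hg := gibbs q (fun v => (p (v.1, v.2.1) * mg13 q v.1 v.2.2) / (q v * mg1 p v.1)) hq.1 hq.2
    (fun v hv => div_pos (mul_pos (h1 v hv) (h2 v hv)) (mul_pos hv (h3 v hv))) 1 one_pos ?_
  · have : info q p = -∑ v, q v *
        Real.logb 2 ((p (v.1, v.2.1) * mg13 q v.1 v.2.2) / (q v * mg1 p v.1)) := by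
      rw [info, ← Finset.sum_neg_distrib]
      refine Finset.sum_congr rfl fun v _ => ?_
      rcases (hq.1 v).eq_or_lt with h0 | h0
      · simp [← h0]
      · rw [Real.logb_div h0.ne' (h2 v h0).ne', Real.logb_div (h1 v h0).ne' (h3 v h0).ne',
          Real.logb_div (mul_pos (h1 v h0) (h2 v h0)).ne' (mul_pos h0 (h3 v h0)).ne',
          Real.logb_mul (h1 v h0).ne' (h2 v h0).ne', Real.logb_mul h0.ne' (h3 v h0).ne']
        ring
    rw [Real.logb_one] at hg
    linarith
  · have hm13 : ∀ a c, 0 ≤ mg13 q a c := fun a c => Finset.sum_nonneg fun b _ => hq.1 _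
    have hm1 : ∀ a, 0 ≤ mg1 p a := fun a => Finset.sum_nonneg fun b _ => hp.1 _
    have e1 : ∀ a, ∑ c, mg13 q a c = mg1 p a := by
      intro a
      unfold mg13 mg1
      rw [Finset.sum_comm]
      exact Finset.sum_congr rfl fun b _ => h a b
    calc _ ≤ ∑ v : A × B × C, p (v.1, v.2.1) * (mg13 q v.1 v.2.2 / mg1 p v.1) := by
          refine Finset.sum_le_sum fun v _ => ?_
          rcases (hq.1 v).eq_or_lt with h0 | h0
          · rw [← h0, zero_mul]
            exact mul_nonneg (hp.1 _) (div_nonneg (hm13 _ _) (hm1 _))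
          · refine le_of_eq ?_
            have := h0.ne'
            have := (h3 v h0).ne'
            field_simp
      _ = ∑ a, ∑ b, p (a, b) * (mg1 p a / mg1 p a) := by
          rw [Fintype.sum_prod_type]
          refine Finset.sum_congr rfl fun a _ => ?_
          rw [Fintype.sum_prod_type]
          refine Finset.sum_congr rfl fun b _ => ?_
          simp only
          rw [← Finset.mul_sum, ← Finset.sum_div, e1]
      _ ≤ ∑ a, ∑ b, p (a, b) := by
          refine Finset.sum_le_sum fun a _ => Finset.sum_le_sum fun b _ => ?_
          exact mul_le_of_le_one_right (hp.1 _) (div_self_le_one _)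
      _ = 1 := by rw [← hp.2, Fintype.sum_prod_type]

theorem hX1X2_nonneg {A B : Type*} [Fintype A] [Fintype B] (p : A × B → ℝ) (hp : IsPMF p) :
    0 ≤ hX1X2 p := by
  rw [hX1X2, ← Finset.sum_neg_distrib]
  refine Finset.sum_nonneg fun x _ => ?_
  rw [neg_nonneg]
  refine mul_nonpos_of_nonneg_of_nonpos (hp.1 x) ?_
  have h2 := le_mg2 p hp.1 x
  have h0 : 0 ≤ mg2 p x.2 := (hp.1 x).trans h2
  exact Real.logb_nonpos (by norm_num) (div_nonneg (hp.1 x) h0) (div_le_one_of_le₀ h2 h0)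

section NLetter

variable {A B C : Type*} [Fintype A] [Fintype B] [Fintype C]

theorem nletter [Nonempty A] [Nonempty C] {D : Type*} (q : A × B × C → ℝ) (hq : IsPMF q)
    (p : A × B → ℝ) (hp : IsPMF p) (h : ∀ a b, (∑ c, q (a, b, c)) = p (a, b))
    (d : B → D → ℝ) (g : A → C → D) (Ed : ℝ) (hEd : ∑ v, q v * d v.2.1 (g v.1 v.2.2) = Ed)
    (δ η : ℝ) (hδ : 0 < δ) (hη : 0 < η) :
    ∃ N : ℕ, ∀ n ≥ N, ∀ M1 N1 M2 : ℕ, 0 < M1 → 0 < N1 → 0 < M2 →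
    ∃ (f1 : (Fin n → A) → Fin M1) (F2 : (Fin n → B) → Fin M1 → Fin N1 × Fin M2)
      (dA : Fin M1 → Fin N1 × Fin M2 → (Fin n → A))
      (dV : Fin M1 → Fin N1 × Fin M2 → (Fin n → C)),
      IT.pr (iidW p n) (fun ω => ¬ (
        dA (f1 (fun t => (ω t).1)) (F2 (fun t => (ω t).2) (f1 (fun t => (ω t).1))) =
          (fun t => (ω t).1) ∧
        ∑ t, d (ω t).2 (g (ω t).1
          (dV (f1 (fun t => (ω t).1)) (F2 (fun t => (ω t).2) (f1 (fun t => (ω t).1))) t)) ≤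
          n * (Ed + δ))) ≤
      (η + (2 : ℝ) ^ (n * (hX1X2 p + δ)) * (1 / M1)) +
      (η + (2 : ℝ) ^ (n * (hX1 p + δ)) * (1 / ((M1 : ℝ) * N1))) +
      ((η + η) + Real.exp (-(M2 / (2 : ℝ) ^ (n * (info q p + δ))))) := by
  classical
  have h1 : ∀ v, 0 < q v → 0 < p (v.1, v.2.1) := fun v hv => hv.trans_le (le_marg q hq.1 p h v)
  have h2 : ∀ v, 0 < q v → 0 < mg13 q v.1 v.2.2 := fun v hv => hv.trans_le (le_mg13 q hq.1 v)
  have h3 : ∀ v, 0 < q v → 0 < mg1 p v.1 := fun v hv => (h1 v hv).trans_le (le_mg1 p hp.1 _)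
  obtain ⟨N1, hN1⟩ := prod_typ p hp (fun x => mg2 p x.2) p
    (fun x hx => hx.trans_le (le_mg2 p hp.1 x)) (fun x hx => hx) (hX1X2 p) (by
      rw [hX1X2, ← Finset.sum_neg_distrib]
      refine Finset.sum_congr rfl fun x _ => ?_
      rw [← inv_div, Real.logb_inv, mul_neg]) δ η hδ hη
  obtain ⟨N3, hN3⟩ := prod_typ p hp (fun x => 1) (fun x => mg1 p x.1)
    (fun x hx => one_pos) (fun x hx => hx.trans_le (le_mg1 p hp.1 x)) (hX1 p) (by
      rw [hX1, ← Finset.sum_neg_distrib]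
      refine Finset.sum_congr rfl fun x _ => ?_
      rw [one_div, Real.logb_inv, mul_neg]) δ η hδ hη
  obtain ⟨N2, hN2⟩ := prod_typ q hq (fun v => q v * mg1 p v.1)
    (fun v => mg13 q v.1 v.2.2 * p (v.1, v.2.1))
    (fun v hv => mul_pos hv (h3 v hv)) (fun v hv => mul_pos (h2 v hv) (h1 v hv)) (info q p) (by
      rw [info]
      refine Finset.sum_congr rfl fun v _ => ?_
      rcases (hq.1 v).eq_or_lt with h0 | h0
      · simp [← h0]
      · rw [Real.logb_div h0.ne' (h2 v h0).ne', Real.logb_div (h1 v h0).ne' (h3 v h0).ne',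
          Real.logb_div (mul_pos h0 (h3 v h0)).ne' (mul_pos (h2 v h0) (h1 v h0)).ne',
          Real.logb_mul (h2 v h0).ne' (h1 v h0).ne', Real.logb_mul h0.ne' (h3 v h0).ne']
        ring) δ η hδ hη
  obtain ⟨N4, hN4⟩ := wlln q hq (fun v => d v.2.1 (g v.1 v.2.2)) δ η hδ hη
  refine ⟨N1 + N2 + N3 + N4, fun n hn M1 M1' M2 hM1 hM1' hM2 => ?_⟩
  have t1 := hN1 n (by omega)
  have t2 := hN2 n (by omega)
  have t3 := hN3 n (by omega)
  have t4 := hN4 n (by omega)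
  rw [hEd] at t4
  set Q : (Fin n → A) → (Fin n → B) → (Fin n → C) → ℝ := fun a b v => ∏ t, q (a t, b t, v t) with hQ
  have sv : ∀ a b, ∑ v, Q a b v = ∏ t, p (a t, b t) := by
    intro a b
    rw [hQ, sum_prod_pi (fun t c => q (a t, b t, c))]
    exact Finset.prod_congr rfl fun t _ => h _ _
  have sb : ∀ a v, ∑ b, Q a b v = ∏ t, mg13 q (a t) (v t) := by
    intro a v
    rw [hQ, sum_prod_pi (fun t b => q (a t, b, v t))]
    rfl
  have sbv : ∀ a, ∑ b, ∑ v, Q a b v = ∏ t, mg1 p (a t) := by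
    intro a
    simp_rw [sv]
    rw [sum_prod_pi (fun t b => p (a t, b))]
    rfl
  obtain ⟨S1, hS1⟩ : ∃ S : (Fin n → A) → (Fin n → B) → Prop, ∀ a b, S a b ↔
      (0 < ∏ t, p (a t, b t) ∧
      ∏ t, mg2 p (b t) ≤ (2 : ℝ) ^ (n * (hX1X2 p + δ)) * ∏ t, p (a t, b t)) :=
    ⟨_, fun _ _ => Iff.rfl⟩
  obtain ⟨S3, hS3⟩ : ∃ S : (Fin n → A) → Prop, ∀ a, S a ↔ (0 < ∏ t, mg1 p (a t) ∧
      ∏ t : Fin n, (1 : ℝ) ≤ (2 : ℝ) ^ (n * (hX1 p + δ)) * ∏ t, mg1 p (a t)) :=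
    ⟨_, fun _ => Iff.rfl⟩
  obtain ⟨Gd, hGd⟩ : ∃ S : (Fin n → A) → (Fin n → B) → (Fin n → C) → Prop, ∀ a b v, S a b v ↔
      (∏ t, (q (a t, b t, v t) * mg1 p (a t)) ≤ (2 : ℝ) ^ (n * (info q p + δ)) *
        ∏ t, (mg13 q (a t) (v t) * p (a t, b t)) ∧
      ∑ t, d (b t) (g (a t) (v t)) ≤ n * (Ed + δ)) := ⟨_, fun _ _ _ => Iff.rfl⟩
  obtain ⟨f1, F2, dA, dV, hfin⟩ := oneshot (iidW p n) (iidW_nonneg p hp.1 n) (sum_iidW p hp n)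
    (fun ω t => (ω t).1) (fun ω t => (ω t).2) Q (fun a b v => Finset.prod_nonneg fun _ _ => hq.1 _)
    (by
      intro F
      rw [sum_pair]
      refine Finset.sum_congr rfl fun a _ => Finset.sum_congr rfl fun b _ => ?_
      rw [sv]
      rfl) S1 S3 Gd ((2 : ℝ) ^ (n * (hX1X2 p + δ))) ((2 : ℝ) ^ (n * (hX1 p + δ)))
      ((2 : ℝ) ^ (n * (info q p + δ))) (by positivity)
      (by
        intro b
        refine list_card (fun a => ∏ t, p (a t, b t))
          (fun a => Finset.prod_nonneg fun _ _ => hp.1 _) _ (by positivity) _ fun a ha => ?_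
        have ha' := (hS1 a b).mp (Finset.mem_filter.mp ha).2
        rw [sum_prod_pi (fun t a => p (a, b t))]
        exact ha')
      (by
        refine list_card (fun a => ∏ t, mg1 p (a t))
          (fun a => Finset.prod_nonneg fun _ _ => Finset.sum_nonneg fun _ _ => hp.1 _)
          _ (by positivity) _ fun a ha => ?_
        have ha' := (hS3 a).mp (Finset.mem_filter.mp ha).2
        rw [sum_prod_pi (fun t a => mg1 p a)]
        rw [sum_mg1 p hp]
        exact ha')
      (by
        intro a b v hg
        rw [sbv, sb, sv]
        have := ((hGd a b v).mp hg).1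
        rw [Finset.prod_mul_distrib, Finset.prod_mul_distrib] at this
        exact this) M1 M1' M2 hM1 hM1' hM2
  refine ⟨f1, F2, dA, dV, le_trans (pr_mono _ (iidW_nonneg p hp.1 n) _ _ ?_) (hfin.trans ?_)⟩
  · intro ω _ hE hc
    exact hE ⟨hc.1, ((hGd _ _ _).mp hc.2).2⟩
  · have tG : ∑ a, ∑ b, ∑ v, (if ¬ Gd a b v then Q a b v else 0) ≤ η + η := by
      have e : ∑ a, ∑ b, ∑ v, (if ¬ Gd a b v then Q a b v else 0) =
          IT.pr (iidW q n) (fun ω => ¬ Gd (fun t => (ω t).1) (fun t => (ω t).2.1)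
            (fun t => (ω t).2.2)) := by
        unfold IT.pr
        rw [sum_pair]
        refine Finset.sum_congr rfl fun a _ => ?_
        rw [sum_pair]
        refine Finset.sum_congr rfl fun b _ => Finset.sum_congr rfl fun v _ => ?_
        congr
      rw [e]
      refine le_trans (le_trans (pr_mono _ (iidW_nonneg q hq.1 n) _ _ ?_)
        (pr_or (iidW q n) (iidW_nonneg q hq.1 n) _ _)) (add_le_add t2 t4)
      intro ω _ hE
      by_contra hcon
      push Not at hcon
      exact hE ((hGd _ _ _).mpr ⟨hcon.1.2, hcon.2⟩)
    simp only [hS1, hS3] at *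
    gcongr
end NLetter

/-! ### Achievability -/

theorem floor_facts (x : ℝ) (hx : 1 ≤ x) : 0 < ⌊x⌋₊ ∧ x / 2 ≤ (⌊x⌋₊ : ℝ) ∧ (⌊x⌋₊ : ℝ) ≤ x := by
  have h1 : 0 < ⌊x⌋₊ := Nat.floor_pos.mpr hx
  refine ⟨h1, ?_, Nat.floor_le (by linarith)⟩
  have h2 := Nat.lt_floor_add_one x
  have h3 : (1 : ℝ) ≤ ⌊x⌋₊ := by exact_mod_cast h1
  linarith

theorem err_bound (n a r δ : ℝ) (M : ℝ) (c : ℝ) (hn : 0 ≤ n) (hc : 0 < c)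
    (hM : (2 : ℝ) ^ (n * (r + δ)) / c ≤ M) (har : a ≤ r) (ε : ℝ) (hε : ε + ε = δ) :
    (2 : ℝ) ^ (n * (a + ε)) * (1 / M) ≤ c * (1 / (2 : ℝ) ^ (n * ε)) := by
  have hx : (0 : ℝ) < 2 ^ (n * ε) := by positivity
  have hM0 : 0 < M := lt_of_lt_of_le (by positivity) hM
  rw [mul_one_div, mul_one_div, div_le_div_iff₀ hM0 hx]
  rw [div_le_iff₀ hc] at hM
  calc (2 : ℝ) ^ (n * (a + ε)) * 2 ^ (n * ε) = 2 ^ (n * (a + δ)) := by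
        rw [← Real.rpow_add (by norm_num), ← hε]; ring_nf
    _ ≤ 2 ^ (n * (r + δ)) := by
        refine Real.rpow_le_rpow_of_exponent_le (by norm_num) ?_
        exact mul_le_mul_of_nonneg_left (by linarith) hn
    _ ≤ c * M := by linarith

open Classical in
theorem sum_affine_ite {Ω : Type*} [Fintype Ω] (w : Ω → ℝ) (h1 : ∑ ω, w ω = 1) (a b : ℝ)
    (E : Ω → Prop) : ∑ ω, w ω * (a + b * (if E ω then 1 else 0)) = a + b * IT.pr w E := by
  simp_rw [mul_add]
  rw [Finset.sum_add_distrib, ← Finset.sum_mul, h1, one_mul, pr_eq, Finset.mul_sum]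
  congr 1
  refine Finset.sum_congr rfl fun ω _ => ?_
  split_ifs <;> ring

theorem achiev_main
    {X1 X2 Xh2 : Type} [Fintype X1] [Fintype X2] [Fintype Xh2]
    [Nonempty X1] [Nonempty X2] [Nonempty Xh2]
    (p : X1 × X2 → ℝ) (hp : IsPMF p)
    (d2 : X2 → Xh2 → ℝ) (hd2 : ∀ x y, 0 ≤ d2 x y)
    (R1 R2 D32 : ℝ) :
(
    (∃ u : ℕ, u ≤ Fintype.card X1 * Fintype.card X2 + 1 ∧
      ∃ q : X1 × X2 × Fin u → ℝ, IsPMF q ∧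
        (∀ a b, (∑ c, q (a, b, c)) = p (a, b)) ∧
        ∃ g : X1 → Fin u → Xh2,
          IT.expect q (fun v => d2 v.2.1 (g v.1 v.2.2)) ≤ D32 ∧
          IT.condH q (fun v => v.1) (fun v => v.2.1) ≤ R1 ∧
          IT.condMutInfo q (fun v => v.2.1) (fun v => v.2.2) (fun v => v.1) ≤ R2 ∧
          IT.H q (fun v => v.1) +
            IT.condMutInfo q (fun v => v.2.1) (fun v => v.2.2) (fun v => v.1) ≤ R1 + R2)) →
    (∀ ε > (0 : ℝ), ∃ (n K : ℕ), 0 < n ∧ ∃ m1 m2 : Fin K → ℕ,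
      (∀ l, 0 < m1 l) ∧ (∀ l, 0 < m2 l) ∧
      ∃ (J1 : (l : Fin K) → (Fin n → X1 × X2) → Fin (m1 l))
        (J2 : (l : Fin K) → (Fin n → X1 × X2) → Fin (m2 l))
        (g31 : ((l : Fin K) → Fin (m1 l)) → ((l : Fin K) → Fin (m2 l)) → Fin n → X1)
        (g32 : ((l : Fin K) → Fin (m1 l)) → ((l : Fin K) → Fin (m2 l)) → Fin n → Xh2),
        -- node 1's message at round `l` is a function of `X₁ⁿ` and node 2's past messages
        (∀ l : Fin K, ∃ f : (Fin n → X1) →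
            ((k : Fin K) → k.val < l.val → Fin (m2 k)) → Fin (m1 l),
          ∀ ω, J1 l ω = f (fun t => (ω t).1) (fun k _ => J2 k ω)) ∧
        -- node 2's message at round `l` is a function of `X₂ⁿ` and node 1's messages up to `l`
        (∀ l : Fin K, ∃ f : (Fin n → X2) →
            ((k : Fin K) → k.val ≤ l.val → Fin (m1 k)) → Fin (m2 l),
          ∀ ω, J2 l ω = f (fun t => (ω t).2) (fun k _ => J1 k ω)) ∧
        -- rates
        (1 / (n : ℝ)) * ∑ l, Real.logb 2 (m1 l) ≤ R1 + ε ∧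
        (1 / (n : ℝ)) * ∑ l, Real.logb 2 (m2 l) ≤ R2 + ε ∧
        -- lossless reconstruction of `X₁ⁿ` at node 3
        IT.pr (iidW p n)
          (fun ω => (fun t => g31 (fun l => J1 l ω) (fun l => J2 l ω) t) ≠
            fun t => (ω t).1) ≤ ε ∧
        -- distortion constraint on the reconstruction of `X₂ⁿ` at node 3
        (1 / (n : ℝ)) * ∑ t : Fin n, IT.expect (iidW p n)
            (fun ω => d2 (ω t).2 (g32 (fun l => J1 l ω) (fun l => J2 l ω) t)) ≤ D32 + ε) := by
  classical
  rintro ⟨u, -, q, hq, h, g, hD, hR1, hR2, hR12⟩ ε hε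
  rw [condH_eq q hq.1 p h] at hR1
  rw [condMutInfo_eq q hq.1 p h] at hR2 hR12
  rw [H_eq q p h] at hR12
  have hI := info_nonneg q hq p hp h
  have hA := hX1X2_nonneg p hp
  have hu : Nonempty (Fin u) := by
    by_contra hu
    rw [not_nonempty_iff] at hu
    have := hq.2
    rw [Fintype.sum_empty] at this
    norm_num at this
  obtain ⟨dm, hdm0, hdm⟩ : ∃ dm : ℝ, 0 ≤ dm ∧ ∀ x y, d2 x y ≤ dm := by
    refine ⟨∑ x, ∑ y, d2 x y, Finset.sum_nonneg fun x _ => Finset.sum_nonneg fun y _ => hd2 x y,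
      fun x y => ?_⟩
    refine (Finset.single_le_sum (fun y _ => hd2 x y) (Finset.mem_univ y)).trans ?_
    exact Finset.single_le_sum (f := fun x => ∑ y, d2 x y)
      (fun x _ => Finset.sum_nonneg fun y _ => hd2 x y) (Finset.mem_univ x)
  set Ed := ∑ v, q v * d2 v.2.1 (g v.1 v.2.2) with hEd
  have hEd0 : 0 ≤ Ed := Finset.sum_nonneg fun v _ => mul_nonneg (hq.1 v) (hd2 _ _)
  have hD' : Ed ≤ D32 := hD
  set δ := ε / 2 with hδ
  have hδ0 : 0 < δ := by positivity
  set e := min ε (δ / (dm + 1)) with he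
  have he0 : 0 < e := lt_min hε (by positivity)
  have hee : dm * e ≤ δ := by
    have : e ≤ δ / (dm + 1) := min_le_right _ _
    rw [le_div_iff₀ (by positivity)] at this
    nlinarith
  obtain ⟨N, hN⟩ := nletter q hq p hp h d2 g Ed hEd.symm δ (e / 8) hδ0 (by positivity)
  have hl2 : 0 < Real.log 2 := Real.log_pos (by norm_num)
  obtain ⟨N', hN'⟩ := exists_nat_ge (16 / (e * δ * Real.log 2))
  set n := N + N' + 1 with hn
  have hn0 : (0 : ℝ) < n := by positivity
  set x := (2 : ℝ) ^ (n * δ) with hx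
  have hx0 : 0 < x := by positivity
  have hxe : 16 / e ≤ x := by
    have h1 : 16 / (e * δ * Real.log 2) ≤ n := hN'.trans (by exact_mod_cast (by omega : N' ≤ n))
    rw [div_le_iff₀ (by positivity)] at h1 ⊢
    have h2 : n * δ * Real.log 2 ≤ x := by
      rw [hx, Real.rpow_def_of_pos (by norm_num)]
      have := Real.add_one_le_exp (Real.log 2 * (n * δ))
      linarith
    nlinarith
  set s := max 0 (hX1 p - R1) with hs
  have hs0 : 0 ≤ s := le_max_left _ _
  have hs1 : hX1 p ≤ R1 + s := by have := le_max_right 0 (hX1 p - R1); linarith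
  have hs2 : s + info q p ≤ R2 := by
    rcases max_choice 0 (hX1 p - R1) with hc | hc <;> rw [hs, hc] <;> linarith
  have one_le : ∀ r : ℝ, 0 ≤ r → (1 : ℝ) ≤ 2 ^ (n * r) := fun r hr =>
    Real.one_le_rpow (by norm_num) (by positivity)
  obtain ⟨pM1, lM1, uM1⟩ := floor_facts _ (one_le (R1 + ε) (by linarith))
  obtain ⟨pN1, lN1, uN1⟩ := floor_facts _ (one_le s hs0)
  obtain ⟨pM2, lM2, uM2⟩ := floor_facts _ (one_le (info q p + ε) (by linarith))
  set M1 := ⌊(2 : ℝ) ^ (n * (R1 + ε))⌋₊ with hM1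
  set N1 := ⌊(2 : ℝ) ^ (n * s)⌋₊ with hN1
  set M2 := ⌊(2 : ℝ) ^ (n * (info q p + ε))⌋₊ with hM2
  obtain ⟨f1, F2, dA, dV, herr⟩ := hN n (by omega) M1 N1 M2 pM1 pN1 pM2
  have hlog : ∀ (M : ℕ) (r : ℝ), 0 < M → (M : ℝ) ≤ 2 ^ (n * r) → Real.logb 2 M ≤ n * r := by
    intro M r hM hle
    have h1 := Real.logb_le_logb_of_le (b := 2) (by norm_num) (by exact_mod_cast hM) hle
    rwa [Real.logb_rpow (by norm_num) (by norm_num)] at h1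
  have herr' : IT.pr (iidW p n) (fun ω => ¬ (
        dA (f1 (fun t => (ω t).1)) (F2 (fun t => (ω t).2) (f1 (fun t => (ω t).1))) =
          (fun t => (ω t).1) ∧
        ∑ t, d2 (ω t).2 (g (ω t).1
          (dV (f1 (fun t => (ω t).1)) (F2 (fun t => (ω t).2) (f1 (fun t => (ω t).1))) t)) ≤
          n * (Ed + δ))) ≤ e := by
    refine herr.trans ?_
    have hεδ : δ + δ = ε := by rw [hδ]; ring
    have e1 := err_bound n (hX1X2 p) R1 ε M1 2 hn0.le (by norm_num) lM1 hR1 δ hεδ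
    have e2 := err_bound n (hX1 p) (R1 + s) ε (M1 * N1) 4 hn0.le (by norm_num) (by
      have := mul_le_mul lM1 lN1 (by positivity) (by positivity)
      refine le_trans (le_of_eq ?_) this
      rw [div_mul_div_comm, ← Real.rpow_add (by norm_num)]
      norm_num
      ring_nf) hs1 δ hεδ
    have e3 : Real.exp (-(M2 / (2 : ℝ) ^ (n * (info q p + δ)))) ≤ 2 * (1 / x) := by
      have h1 : x / 2 ≤ M2 / (2 : ℝ) ^ (n * (info q p + δ)) := by
        rw [le_div_iff₀ (by positivity)]
        refine le_trans (le_of_eq ?_) lM2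
        rw [div_mul_eq_mul_div, hx, ← Real.rpow_add (by norm_num), ← hεδ]
        ring_nf
      have h2 := Real.add_one_le_exp (x / 2)
      calc _ ≤ Real.exp (-(x / 2)) := Real.exp_le_exp.mpr (by linarith)
        _ = (Real.exp (x / 2))⁻¹ := Real.exp_neg _
        _ ≤ (x / 2)⁻¹ := inv_anti₀ (by positivity) (by linarith)
        _ = _ := by field_simp
    have e4 : 1 / x ≤ e / 16 := by
      rw [div_le_iff₀ he0] at hxe
      rw [div_le_div_iff₀ hx0 (by norm_num)]
      linarith
    linarith
  have hnn := iidW_nonneg p hp.1 n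
  refine ⟨n, 1, by omega, fun _ => M1, fun _ => N1 * M2, fun _ => pM1, fun _ => Nat.mul_pos pN1 pM2,
    fun _ ω => f1 (fun t => (ω t).1),
    fun _ ω => finProdFinEquiv (F2 (fun t => (ω t).2) (f1 (fun t => (ω t).1))),
    fun j k t => dA (j 0) (finProdFinEquiv.symm (k 0)) t,
    fun j k t => g (dA (j 0) (finProdFinEquiv.symm (k 0)) t)
      (dV (j 0) (finProdFinEquiv.symm (k 0)) t), ?_, ?_, ?_, ?_, ?_, ?_⟩
  · exact fun l => ⟨fun a _ => f1 a, fun ω => rfl⟩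
  · exact fun l => ⟨fun b j => finProdFinEquiv (F2 b (j l le_rfl)), fun ω => rfl⟩
  · have := hlog M1 (R1 + ε) pM1 uM1
    rw [Fin.sum_univ_one, one_div, inv_mul_le_iff₀ hn0]
    exact this
  · have h1 := hlog N1 s pN1 uN1
    have h2 := hlog M2 (info q p + ε) pM2 uM2
    rw [Fin.sum_univ_one, one_div, inv_mul_le_iff₀ hn0]
    push_cast
    rw [Real.logb_mul (by positivity) (by positivity)]
    have := mul_le_mul_of_nonneg_left hs2 hn0.le
    linarith
  · simp only [Equiv.symm_apply_apply]
    refine le_trans (pr_mono _ hnn _ _ ?_) (herr'.trans (min_le_left _ _))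
    intro ω _ hE hc
    exact hE hc.1
  · simp only [Equiv.symm_apply_apply]
    have hsum : ∑ t : Fin n, IT.expect (iidW p n) (fun ω => d2 (ω t).2
        (g (dA (f1 (fun t => (ω t).1)) (F2 (fun t => (ω t).2) (f1 (fun t => (ω t).1))) t)
          (dV (f1 (fun t => (ω t).1)) (F2 (fun t => (ω t).2) (f1 (fun t => (ω t).1))) t))) ≤
        n * (Ed + δ) + n * dm * e := by
      obtain ⟨E, hE⟩ : ∃ E : (Fin n → X1 × X2) → Prop, ∀ ω, E ω ↔ ¬ (
        dA (f1 (fun t => (ω t).1)) (F2 (fun t => (ω t).2) (f1 (fun t => (ω t).1))) =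
          (fun t => (ω t).1) ∧
        ∑ t, d2 (ω t).2 (g (ω t).1
          (dV (f1 (fun t => (ω t).1)) (F2 (fun t => (ω t).2) (f1 (fun t => (ω t).1))) t)) ≤
          n * (Ed + δ)) := ⟨_, fun _ => Iff.rfl⟩
      have herr2 : IT.pr (iidW p n) E ≤ e :=
        le_trans (pr_mono _ hnn _ _ fun ω _ hc => (hE ω).mp hc) herr'
      unfold IT.expect
      rw [Finset.sum_comm]
      calc _ ≤ ∑ ω, iidW p n ω * (n * (Ed + δ) + n * dm * (if E ω then 1 else 0)) := by
            refine Finset.sum_le_sum fun ω _ => ?_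
            rw [← Finset.mul_sum]
            refine mul_le_mul_of_nonneg_left ?_ (hnn ω)
            by_cases hc : (
              dA (f1 (fun t => (ω t).1)) (F2 (fun t => (ω t).2) (f1 (fun t => (ω t).1))) =
                (fun t => (ω t).1) ∧
              ∑ t, d2 (ω t).2 (g (ω t).1
                (dV (f1 (fun t => (ω t).1)) (F2 (fun t => (ω t).2) (f1 (fun t => (ω t).1))) t)) ≤
                n * (Ed + δ))
            · rw [if_neg (fun hh => (hE ω).mp hh hc), mul_zero, add_zero]
              beta_reduce
              rw [hc.1]
              exact hc.2
            · rw [if_pos ((hE ω).mpr hc), mul_one]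
              have : ∀ F : Fin n → Xh2, ∑ t, d2 (ω t).2 (F t) ≤ n * dm := by
                intro F
                refine (Finset.sum_le_sum fun t _ => hdm _ _).trans ?_
                simp
              refine (this _).trans ?_
              have : 0 ≤ n * (Ed + δ) := by positivity
              linarith
        _ = n * (Ed + δ) + n * dm * IT.pr (iidW p n) (fun ω => E ω) := by
            exact sum_affine_ite _ (sum_iidW p hp n) _ _ _
        _ ≤ _ := by
            have := mul_le_mul_of_nonneg_left herr2 (by positivity : 0 ≤ n * dm)
            linarith
    rw [one_div, inv_mul_le_iff₀ hn0]
    refine hsum.trans ?_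
    have h1 := mul_le_mul_of_nonneg_left hee hn0.le
    have h2 := mul_le_mul_of_nonneg_left hD' hn0.le
    have h3 : n * ε = n * δ + n * δ := by rw [hδ]; ring
    nlinarith


/-- **Theorem 2** (two encoders, one decoder, lossless/lossy reconstruction, no side
information).  Node 3 observes no source and sends no messages; nodes 1 and 2 interact
over `K` rounds (node 1 acting first in each round); at the end, node 3 must reconstruct
`X₁ⁿ` losslessly and `X₂ⁿ` within average distortion `D32`.  The rate pair `(R1, R2)` is
achievable iff it lies in the single-letter region described on the right-hand side. -/
theorem two_encoders_one_decoder_lossy_lossless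
    {X1 X2 Xh2 : Type} [Fintype X1] [Fintype X2] [Fintype Xh2]
    [Nonempty X1] [Nonempty X2] [Nonempty Xh2]
    (p : X1 × X2 → ℝ) (hp : IsPMF p)
    (d2 : X2 → Xh2 → ℝ) (hd2 : ∀ x y, 0 ≤ d2 x y)
    (R1 R2 D32 : ℝ) :
    (∀ ε > (0 : ℝ), ∃ (n K : ℕ), 0 < n ∧ ∃ m1 m2 : Fin K → ℕ,
      (∀ l, 0 < m1 l) ∧ (∀ l, 0 < m2 l) ∧
      ∃ (J1 : (l : Fin K) → (Fin n → X1 × X2) → Fin (m1 l))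
        (J2 : (l : Fin K) → (Fin n → X1 × X2) → Fin (m2 l))
        (g31 : ((l : Fin K) → Fin (m1 l)) → ((l : Fin K) → Fin (m2 l)) → Fin n → X1)
        (g32 : ((l : Fin K) → Fin (m1 l)) → ((l : Fin K) → Fin (m2 l)) → Fin n → Xh2),
        -- node 1's message at round `l` is a function of `X₁ⁿ` and node 2's past messages
        (∀ l : Fin K, ∃ f : (Fin n → X1) →
            ((k : Fin K) → k.val < l.val → Fin (m2 k)) → Fin (m1 l),
          ∀ ω, J1 l ω = f (fun t => (ω t).1) (fun k _ => J2 k ω)) ∧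
        -- node 2's message at round `l` is a function of `X₂ⁿ` and node 1's messages up to `l`
        (∀ l : Fin K, ∃ f : (Fin n → X2) →
            ((k : Fin K) → k.val ≤ l.val → Fin (m1 k)) → Fin (m2 l),
          ∀ ω, J2 l ω = f (fun t => (ω t).2) (fun k _ => J1 k ω)) ∧
        -- rates
        (1 / (n : ℝ)) * ∑ l, Real.logb 2 (m1 l) ≤ R1 + ε ∧
        (1 / (n : ℝ)) * ∑ l, Real.logb 2 (m2 l) ≤ R2 + ε ∧
        -- lossless reconstruction of `X₁ⁿ` at node 3
        IT.pr (iidW p n)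
          (fun ω => (fun t => g31 (fun l => J1 l ω) (fun l => J2 l ω) t) ≠
            fun t => (ω t).1) ≤ ε ∧
        -- distortion constraint on the reconstruction of `X₂ⁿ` at node 3
        (1 / (n : ℝ)) * ∑ t : Fin n, IT.expect (iidW p n)
            (fun ω => d2 (ω t).2 (g32 (fun l => J1 l ω) (fun l => J2 l ω) t)) ≤ D32 + ε)
    ↔
    (∃ u : ℕ, u ≤ Fintype.card X1 * Fintype.card X2 + 1 ∧
      ∃ q : X1 × X2 × Fin u → ℝ, IsPMF q ∧
        (∀ a b, (∑ c, q (a, b, c)) = p (a, b)) ∧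
        ∃ g : X1 → Fin u → Xh2,
          IT.expect q (fun v => d2 v.2.1 (g v.1 v.2.2)) ≤ D32 ∧
          IT.condH q (fun v => v.1) (fun v => v.2.1) ≤ R1 ∧
          IT.condMutInfo q (fun v => v.2.1) (fun v => v.2.2) (fun v => v.1) ≤ R2 ∧
          IT.H q (fun v => v.1) +
            IT.condMutInfo q (fun v => v.2.1) (fun v => v.2.2) (fun v => v.1) ≤ R1 + R2) := by
  exact ⟨converse_main p hp d2 hd2 R1 R2 D32, achiev_main p hp d2 hd2 R1 R2 D32⟩
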